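/- arXiv:1404.0599 — 3 statements merged into one kernel-verified Lean document; each statement's English description precedes it below -/
import Mathlib

section
/- Let φ be a continuous flow on the closed unit disc D = {p ∈ ℝ² : |p| ≤ 1} with finitely many singular points, and let p be an interior point of D that is a repeller fixed point of φ (p is asymptotically stable for the inverse flow φ⁻¹ given by φ⁻¹_t = φ_{−t}). Assume that for every interior point x of D with x ≠ p, the ω-limit set of x equals the boundary circle ∂D. Then φ admits a time change that is kinematic expansive. -/
open Metric Set Filter Topology

/-- A continuous flow on a metric space. -/
def IsFlow {X : Type*} [MetricSpace X] (φ : ℝ → X → X) : Prop :=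
  Continuous (fun p : ℝ × X => φ p.1 p.2) ∧ (∀ x, φ 0 x = x) ∧
    ∀ s t x, φ s (φ t x) = φ (s + t) x

/-- Kinematic expansiveness. -/
def KinematicExpansive {X : Type*} [MetricSpace X] (φ : ℝ → X → X) : Prop :=
  ∀ ε > (0 : ℝ), ∃ δ > (0 : ℝ), ∀ x y : X,
    (∀ t : ℝ, dist (φ t x) (φ t y) < δ) → ∃ s : ℝ, |s| < ε ∧ y = φ s x

/-- `ψ` is a time change of `φ`. -/
def IsTimeChange {X : Type*} [MetricSpace X] (φ ψ : ℝ → X → X) : Prop :=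
  IsFlow ψ ∧ ∃ h : ℝ → X → ℝ,
    Continuous (fun p : ℝ × X => h p.1 p.2) ∧ (∀ x, h 0 x = 0) ∧
    (∀ x, StrictMono fun t => h t x) ∧ (∀ x, Function.Surjective fun t => h t x) ∧
    ∀ t x, ψ t x = φ (h t x) x

/-- `p` is an asymptotically stable singular point of `φ`. -/
def AsympStable {X : Type*} [MetricSpace X] (φ : ℝ → X → X) (p : X) : Prop :=
  (∀ ε > (0 : ℝ), ∃ δ > (0 : ℝ), ∀ x : X, dist x p < δ →
      ∀ t : ℝ, 0 ≤ t → dist (φ t x) p < ε) ∧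
    ∃ δ₀ > (0 : ℝ), ∀ x : X, dist x p < δ₀ →
      Filter.Tendsto (fun t => φ t x) Filter.atTop (nhds p)

/-- The ω-limit set of `x`. -/
def OmegaLimit {X : Type*} [MetricSpace X] (φ : ℝ → X → X) (x : X) : Set X :=
  {y | ∃ u : ℕ → ℝ, Filter.Tendsto u Filter.atTop Filter.atTop ∧
    Filter.Tendsto (fun k => φ (u k) x) Filter.atTop (nhds y)}

set_option linter.unusedSectionVars false

theorem exists_log_lift {A : Type*} [TopologicalSpace A] (u : ℝ × A → ℂ) (hu : Continuous u)
    (hne : ∀ x, u x ≠ 0) (v : A → ℂ) (hv : Continuous v)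
    (h0 : ∀ a, Complex.exp (v a) = u (0, a)) :
    ∃ V : ℝ × A → ℂ, Continuous V ∧ (∀ x, Complex.exp (V x) = u x) ∧ ∀ a, V (0, a) = v a := by
  let H : C(unitInterval × (ℝ × A), {z : ℂ // z ≠ 0}) :=
    ⟨fun x => ⟨u (x.1 * x.2.1, x.2.2), hne _⟩, by fun_prop⟩
  let f : C(ℝ × A, ℂ) := ⟨fun x => v x.2, by fun_prop⟩
  have H0 : ∀ a, H (0, a) = (fun z : ℂ => (⟨_, z.exp_ne_zero⟩ : {z : ℂ // z ≠ 0})) (f a) := by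
    intro a
    apply Subtype.ext
    simp [H, f, h0]
  let G := Complex.isCoveringMap_exp.liftHomotopy H f H0
  have hG : ∀ x, Complex.exp (G x) = u (x.1 * x.2.1, x.2.2) := fun x =>
    congrArg Subtype.val (congrFun (Complex.isCoveringMap_exp.liftHomotopy_lifts H f H0) x)
  refine ⟨fun x => G (1, x), by fun_prop, fun x => by simpa using hG (1, x), fun a => ?_⟩
  have h1 : ∀ s : unitInterval, G (s, (0, a)) = G (0, (0, a)) := by
    have := Complex.isCoveringMap_exp.isLocalHomeomorph
    intro s
    have key := Complex.isCoveringMap_exp.eq_of_comp_eq (A := unitInterval)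
      (g₁ := fun s => G (s, (0, a))) (g₂ := fun _ => G (0, (0, a)))
      (by fun_prop) (by fun_prop) (by
        funext s
        apply Subtype.ext
        simp [hG]) 0 rfl
    exact congrFun key s
  have h2 : G (0, (0, a)) = f (0, a) := Complex.isCoveringMap_exp.liftHomotopy_zero H f H0 _
  simpa [h2, f] using h1 1

theorem IsPreconnected.eq_of_int_valued {α : Type*} [TopologicalSpace α] {S : Set α}
    (hS : IsPreconnected S) {f : α → ℝ} (hf : ContinuousOn f S) (h_int : ∀ x ∈ S, ∃ n : ℤ, f x = n)
    {x y : α} (hx : x ∈ S) (hy : y ∈ S) : f x = f y := by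
  have hd : DiscreteTopology (range ((↑) : ℤ → ℝ)) :=
    (Int.isClosedEmbedding_coe_real.isEmbedding.toHomeomorph).symm.isEmbedding.discreteTopology
  exact hS.constant_of_mapsTo (T := range ((↑) : ℤ → ℝ)) ⟨hd⟩ hf
    (fun x hx => by obtain ⟨n, hn⟩ := h_int x hx; exact ⟨n, hn.symm⟩) hx hy

theorem Complex.exists_im_eq_arg_exp (w : ℂ) :
    ∃ n : ℤ, w.im = 2 * Real.pi * n + (Complex.exp w).arg := by
  have h : Complex.exp w = Complex.exp (Complex.log (Complex.exp w)) :=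
    (Complex.exp_log (Complex.exp_ne_zero w)).symm
  obtain ⟨n, hn⟩ := Complex.exp_eq_exp_iff_exists_int.1 h
  refine ⟨n, ?_⟩
  have := congrArg Complex.im hn
  simp [Complex.log_im] at this
  rw [this]; ring

theorem Complex.re_eq_log_norm_exp (w : ℂ) : w.re = Real.log ‖Complex.exp w‖ := by
  rw [Complex.norm_exp, Real.log_exp]

theorem IsPreconnected.im_eq_arg_exp {α : Type*} [TopologicalSpace α] {S : Set α}
    (hS : IsPreconnected S) {ν : α → ℂ} (hν : ContinuousOn ν S)
    (hre : ∀ x ∈ S, 0 < (Complex.exp (ν x)).re) {n : ℤ} {a : α} (ha : a ∈ S)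
    (hn : (ν a).im = 2 * Real.pi * n + (Complex.exp (ν a)).arg) {x : α} (hx : x ∈ S) :
    (ν x).im = 2 * Real.pi * n + (Complex.exp (ν x)).arg := by
  have hpi := Real.pi_pos
  have hc : ContinuousOn (fun x => ((ν x).im - (Complex.exp (ν x)).arg) / (2 * Real.pi)) S := by
    apply ContinuousOn.div_const
    apply ContinuousOn.sub
    · exact Complex.continuous_im.comp_continuousOn hν
    · intro x hx
      exact (Complex.continuousAt_arg (Or.inl (hre x hx))).comp_continuousWithinAt
        (f := fun x => Complex.exp (ν x)) (hν x hx).cexp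
  have := hS.eq_of_int_valued hc (fun x _ => by
    obtain ⟨m, hm⟩ := Complex.exists_im_eq_arg_exp (ν x)
    refine ⟨m, ?_⟩
    rw [hm]; field_simp; ring) ha hx
  rw [hn] at this
  field_simp at this
  linarith

theorem im_mem_of_quarter_turn {H : ℝ → ℂ} {a b α : ℝ} {u : Set ℝ} (hu : IsPreconnected u)
    (hH : ContinuousOn H u) (ha : a ∈ u) (hb : b ∈ u)
    (hre : ∀ x ∈ u, 0 < (Complex.exp (H x - α * Complex.I)).re)
    (hb0 : 0 < (Complex.exp (H b - α * Complex.I)).im)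
    (h1 : α - Real.pi / 2 < (H a).im) (h2 : (H a).im < α + Real.pi / 2) :
    α < (H b).im ∧ (H b).im < α + Real.pi / 2 := by
  have hpi := Real.pi_pos
  have key := hu.im_eq_arg_exp (ν := fun x => H x - α * Complex.I)
    (by fun_prop) hre (n := 0) ha (by
      obtain ⟨n, hn⟩ := Complex.exists_im_eq_arg_exp (H a - α * Complex.I)
      have h3 := abs_lt.1 (Complex.abs_arg_lt_pi_div_two_iff.2 (Or.inl (hre a ha)))
      have h4 : (H a - α * Complex.I).im = (H a).im - α := by simp
      rw [h4] at hn
      have h5 : n = 0 := by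
        have : (n : ℝ) < 1 := by
          by_contra! h; nlinarith
        have : (-1 : ℝ) < n := by
          by_contra! h; nlinarith
        have h6 : n < 1 := by exact_mod_cast ‹(n : ℝ) < 1›
        have h7 : -1 < n := by exact_mod_cast this
        omega
      subst h5
      rw [h4, hn]) hb
  have h3 := abs_lt.1 (Complex.abs_arg_lt_pi_div_two_iff.2 (Or.inl (hre b hb)))
  have h4 : (H b - α * Complex.I).im = (H b).im - α := by simp
  have h5 : 0 < (Complex.exp (H b - α * Complex.I)).arg := by
    rcases lt_trichotomy (Complex.exp (H b - α * Complex.I)).arg 0 with h | h | h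
    · rw [Complex.arg_neg_iff] at h; linarith
    · have := (Complex.arg_eq_zero_iff.1 h).2; linarith
    · exact h
  simp only [h4] at key
  simp at key
  constructor <;> linarith [key]

/-- Two-dimensional Poincaré–Miranda theorem. -/
theorem exists_zero_of_signs {F : ℝ × ℝ → ℂ} (hF : Continuous F) {a b c d : ℝ} (hab : a ≤ b)
    (hcd : c ≤ d) (h1 : ∀ s ∈ Icc a b, (F (s, c)).re < 0) (h2 : ∀ s ∈ Icc a b, 0 < (F (s, d)).re)
    (h3 : ∀ t ∈ Icc c d, (F (a, t)).im < 0) (h4 : ∀ t ∈ Icc c d, 0 < (F (b, t)).im) :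
    ∃ s ∈ Icc a b, ∃ t ∈ Icc c d, F (s, t) = 0 := by
  by_contra! hne
  have hpi := Real.pi_pos
  let P : ℝ × ℝ → ℝ × ℝ := fun x => (projIcc a b hab x.1, projIcc c d hcd x.2)
  have hP : Continuous P := by fun_prop
  have hPn : ∀ x, F (P x) ≠ 0 := fun x => hne _ (projIcc a b hab x.1).2 _ (projIcc c d hcd x.2).2
  have hPe : ∀ s ∈ Icc a b, ∀ t ∈ Icc c d, P (s, t) = (s, t) := by
    intro s hs t ht
    simp [P, projIcc_of_mem hab hs, projIcc_of_mem hcd ht]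
  obtain ⟨v, hv, hv', -⟩ := exists_log_lift (A := Unit) (fun x => F (P (0, x.1)))
    (by fun_prop) (fun x => hPn _) (fun _ => Complex.log (F (P (0, 0)))) (by fun_prop)
    (fun _ => Complex.exp_log (hPn _))
  obtain ⟨G, hG, hG', -⟩ := exists_log_lift (A := ℝ) (fun x => F (P x)) (by fun_prop) hPn
    (fun t => v (t, ())) (by fun_prop) (fun t => hv' _)
  have hGe : ∀ s ∈ Icc a b, ∀ t ∈ Icc c d, Complex.exp (G (s, t)) = F (s, t) :=
    fun s hs t ht => by rw [hG', hPe s hs t ht]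
  have ha := left_mem_Icc.2 hab
  have hb := right_mem_Icc.2 hab
  have hc := left_mem_Icc.2 hcd
  have hd := right_mem_Icc.2 hcd
  obtain ⟨n, hn⟩ := Complex.exists_im_eq_arg_exp (G (b, d))
  rw [hGe b hb d hd] at hn
  have e0 : Complex.exp (((2 * Real.pi * n : ℝ) : ℂ) * Complex.I) = 1 := by
    rw [Complex.exp_eq_one_iff]; exact ⟨n, by push_cast; ring⟩
  have r0 : ∀ w, Complex.exp (w - ((2 * Real.pi * n : ℝ) : ℂ) * Complex.I) = Complex.exp w := by
    intro w; rw [Complex.exp_sub, e0, div_one]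
  have r1 : ∀ w, Complex.exp (w - ((2 * Real.pi * n + Real.pi / 2 : ℝ) : ℂ) * Complex.I)
      = -Complex.I * Complex.exp w := by
    intro w
    rw [show w - ((2 * Real.pi * n + Real.pi / 2 : ℝ) : ℂ) * Complex.I = (w -
      ((2 * Real.pi * n : ℝ) : ℂ) * Complex.I) - Real.pi / 2 * Complex.I by push_cast; ring,
      Complex.exp_sub, r0, Complex.exp_pi_div_two_mul_I, Complex.div_I]; ring
  have r2 : ∀ w, Complex.exp (w - ((2 * Real.pi * n + Real.pi : ℝ) : ℂ) * Complex.I)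
      = - Complex.exp w := by
    intro w
    rw [show w - ((2 * Real.pi * n + Real.pi : ℝ) : ℂ) * Complex.I = (w -
      ((2 * Real.pi * n : ℝ) : ℂ) * Complex.I) - Real.pi * Complex.I by push_cast; ring,
      Complex.exp_sub, r0, Complex.exp_pi_mul_I, div_neg, div_one]
  have r3 : ∀ w, Complex.exp (w - ((2 * Real.pi * n + 3 * Real.pi / 2 : ℝ) : ℂ) * Complex.I)
      = Complex.I * Complex.exp w := by
    intro w
    rw [show w - ((2 * Real.pi * n + 3 * Real.pi / 2 : ℝ) : ℂ) * Complex.I = (w -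
      ((2 * Real.pi * n + Real.pi : ℝ) : ℂ) * Complex.I) - Real.pi / 2 * Complex.I by
      push_cast; ring, Complex.exp_sub, r2, Complex.exp_pi_div_two_mul_I, Complex.div_I]; ring
  have q := abs_lt.1 (Complex.abs_arg_lt_pi_div_two_iff.2 (Or.inl (h2 b hb)))
  obtain ⟨q1, q1'⟩ := im_mem_of_quarter_turn (H := fun t => G (b, t)) (a := d) (b := c)
    (α := 2 * Real.pi * n + Real.pi / 2) (isPreconnected_Icc (a := c) (b := d)) (by fun_prop) hd hc
    (fun t ht => by rw [r1, hGe b hb t ht]; simpa using h4 t ht)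
    (by rw [r1, hGe b hb c hc]; simpa using h1 b hb)
    (by
      have h5 : 0 ≤ (F (b, d)).arg := Complex.arg_nonneg_iff.2 (h4 d hd).le
      have h6 : (F (b, d)).arg ≠ 0 := fun h => (h4 d hd).ne' (Complex.arg_eq_zero_iff.1 h).2
      have h7 := lt_of_le_of_ne h5 h6.symm
      rw [hn]; linarith) (by rw [hn]; linarith [q.2])
  obtain ⟨q2, q2'⟩ := im_mem_of_quarter_turn (H := fun s => G (s, c)) (a := b) (b := a)
    (α := 2 * Real.pi * n + Real.pi) (isPreconnected_Icc (a := a) (b := b)) (by fun_prop) hb ha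
    (fun t ht => by rw [r2, hGe t ht c hc]; simpa using h1 t ht)
    (by rw [r2, hGe a ha c hc]; simpa using h3 c hc) (by linarith) (by linarith)
  obtain ⟨q3, q3'⟩ := im_mem_of_quarter_turn (H := fun t => G (a, t)) (a := c) (b := d)
    (α := 2 * Real.pi * n + 3 * Real.pi / 2) (isPreconnected_Icc (a := c) (b := d))
    (by fun_prop) hc hd
    (fun t ht => by rw [r3, hGe a ha t ht]; simpa using h3 t ht)
    (by rw [r3, hGe a ha d hd]; simpa using h2 a ha) (by linarith) (by linarith)
  have key := (isPreconnected_Icc (a := a) (b := b)).im_eq_arg_exp (ν := fun s => G (s, d))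
    (by fun_prop) (fun s hs => by rw [hGe s hs d hd]; exact h2 s hs) (n := n) hb
    (by rw [hGe b hb d hd]; exact hn) ha
  simp only [hGe a ha d hd] at key
  have q' := abs_lt.1 (Complex.abs_arg_lt_pi_div_two_iff.2 (Or.inl (h2 a ha)))
  linarith [q'.2]

section Flow

variable {X : Type*} [MetricSpace X] {φ : ℝ → X → X}

theorem IsFlow.continuous₂ (h : IsFlow φ) {α : Type*} [TopologicalSpace α] {f : α → ℝ} {g : α → X}
    (hf : Continuous f) (hg : Continuous g) : Continuous fun a => φ (f a) (g a) :=
  h.1.comp (hf.prodMk hg)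

theorem IsFlow.zero (h : IsFlow φ) (x : X) : φ 0 x = x := h.2.1 x

theorem IsFlow.add (h : IsFlow φ) (s t : ℝ) (x : X) : φ s (φ t x) = φ (s + t) x := h.2.2 s t x

theorem IsFlow.neg_apply (h : IsFlow φ) (t : ℝ) (x : X) : φ (-t) (φ t x) = x := by
  rw [h.add, neg_add_cancel, h.zero]

theorem IsFlow.apply_neg (h : IsFlow φ) (t : ℝ) (x : X) : φ t (φ (-t) x) = x := by
  rw [h.add, add_neg_cancel, h.zero]

theorem IsFlow.injective (h : IsFlow φ) (t : ℝ) : Function.Injective (φ t) :=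
  fun x y hxy => by rw [← h.neg_apply t x, hxy, h.neg_apply]

theorem IsFlow.sub_eq (h : IsFlow φ) {s t : ℝ} {x : X} (hst : φ s x = φ t x) :
    φ (s - t) x = x := by
  have := congrArg (φ (-t)) hst
  rwa [h.neg_apply, h.add, neg_add_eq_sub] at this

theorem IsFlow.exists_no_period (h : IsFlow φ) {w : X} (hw : ∃ t, φ t w ≠ w) :
    ∃ u₀ > 0, ∀ u, |u| ≤ u₀ → φ u w = w → u = 0 := by
  let S : AddSubgroup ℝ :=
    { carrier := {u | φ u w = w}
      zero_mem' := h.zero w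
      add_mem' := by
        intro a b ha hb
        simp only [mem_ofPred_eq] at *
        rw [← h.add, hb, ha]
      neg_mem' := by
        intro a ha
        simp only [mem_ofPred_eq] at *
        conv_lhs => rw [← ha]
        exact h.neg_apply a w }
  have hcl : IsClosed (S : Set ℝ) :=
    isClosed_eq (h.continuous₂ continuous_id continuous_const) continuous_const
  rcases S.dense_or_cyclic with hd | ⟨a, ha⟩
  · obtain ⟨t, ht⟩ := hw
    exact absurd (show t ∈ (S : Set ℝ) by rw [← hcl.closure_eq]; exact hd t) ht
  · by_cases ha0 : a = 0
    · refine ⟨1, one_pos, fun u _ hu => ?_⟩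
      have : u ∈ S := hu
      rw [ha, ha0, AddSubgroup.mem_closure_singleton] at this
      obtain ⟨n, hn⟩ := this
      simpa using hn.symm
    · have hpos := abs_pos.2 ha0
      refine ⟨|a| / 2, by positivity, fun u hu' hu => ?_⟩
      have : u ∈ S := hu
      rw [ha, AddSubgroup.mem_closure_singleton] at this
      obtain ⟨n, hn⟩ := this
      by_contra hu0
      have hn0 : n ≠ 0 := by rintro rfl; simp at hn; exact hu0 hn.symm
      have h1 : (1 : ℝ) ≤ |(n : ℝ)| := by
        have := Int.one_le_abs hn0
        exact_mod_cast this
      rw [← hn, zsmul_eq_mul, abs_mul] at hu'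
      nlinarith

theorem exists_mem_omegaLimit [CompactSpace X] {x : X} {K : Set X} (hK : IsClosed K)
    (h : ∀ N : ℝ, ∃ t ≥ N, φ t x ∈ K) : ∃ y ∈ K, y ∈ OmegaLimit φ x := by
  choose u hu hu' using fun n : ℕ => h n
  obtain ⟨y, g, hg, hy⟩ := CompactSpace.tendsto_subseq fun n => φ (u n) x
  refine ⟨y, hK.mem_of_tendsto hy (Eventually.of_forall fun n => hu' _), fun n => u (g n), ?_, hy⟩
  exact (tendsto_atTop_mono hu tendsto_natCast_atTop_atTop).comp hg.tendsto_atTop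

theorem exists_near_of_mem_omegaLimit {x y : X} (h : y ∈ OmegaLimit φ x) {ε : ℝ} (hε : 0 < ε)
    (N : ℝ) : ∃ t ≥ N, dist (φ t x) y < ε := by
  obtain ⟨u, hu, hu'⟩ := h
  obtain ⟨n, hn1, hn2⟩ := ((hu.eventually_ge_atTop N).and
    (hu'.eventually (ball_mem_nhds y hε))).exists
  exact ⟨u n, hn1, hn2⟩

theorem IsFlow.mem_omegaLimit (h : IsFlow φ) {x y : X} (hy : y ∈ OmegaLimit φ x) (t : ℝ) :
    φ t y ∈ OmegaLimit φ x := by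
  obtain ⟨u, hu, hu'⟩ := hy
  refine ⟨fun n => t + u n, tendsto_atTop_add_const_left _ _ hu, ?_⟩
  simp_rw [← h.add]
  exact ((h.continuous₂ continuous_const continuous_id).tendsto y).comp hu'

end Flow

/-- A flow on a topological disc, embedded in `ℂ` as the closed unit disc by `e`, with finitely
many fixed points, a repelling interior fixed point `p`, and such that the boundary circle is the
ω-limit of every other interior point. -/
structure DiscFlow {X : Type*} [MetricSpace X] (φ : ℝ → X → X) (e : X → ℂ) (p : X) : Prop where
  flow : IsFlow φ
  cont : Continuous e
  inj : Function.Injective e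
  range_eq : range e = closedBall 0 1
  fin : {q | ∀ t, φ t q = q}.Finite
  norm_p : ‖e p‖ < 1
  fix_p : ∀ t, φ t p = p
  rep : AsympStable (fun t x => φ (-t) x) p
  omega : ∀ x, ‖e x‖ < 1 → x ≠ p → OmegaLimit φ x = {z | ‖e z‖ = 1}

namespace DiscFlow

variable {X : Type*} [MetricSpace X] [CompactSpace X] {φ : ℝ → X → X} {e : X → ℂ} {p : X}

theorem norm_le (h : DiscFlow φ e p) (x : X) : ‖e x‖ ≤ 1 := by
  have : e x ∈ range e := mem_range_self x
  rw [h.range_eq] at this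
  simpa using this

theorem exists_eq (h : DiscFlow φ e p) {w : ℂ} (hw : ‖w‖ ≤ 1) : ∃ x, e x = w := by
  have : w ∈ closedBall (0 : ℂ) 1 := by simpa using hw
  rw [← h.range_eq] at this
  exact this

theorem exists_interior (h : DiscFlow φ e p) : ∃ x, ‖e x‖ < 1 ∧ x ≠ p := by
  obtain ⟨x, hx⟩ := h.exists_eq (w := 0) (by simp)
  obtain ⟨y, hy⟩ := h.exists_eq (w := 1 / 2) (by norm_num)
  by_cases hxp : x = p
  · refine ⟨y, by rw [hy]; norm_num, ?_⟩
    rintro rfl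
    rw [hxp, hy] at hx
    norm_num at hx
  · exact ⟨x, by rw [hx]; simp, hxp⟩

theorem continuous_orbit (h : DiscFlow φ e p) (y : X) : Continuous fun t => e (φ t y) :=
  h.cont.comp (h.flow.continuous₂ continuous_id continuous_const)

theorem norm_flow_eq_one (h : DiscFlow φ e p) {x : X} (hx : ‖e x‖ = 1) (t : ℝ) :
    ‖e (φ t x)‖ = 1 := by
  obtain ⟨y, hy, hyp⟩ := h.exists_interior
  have h1 := h.omega y hy hyp
  have h2 : x ∈ OmegaLimit φ y := by rw [h1]; exact hx
  have h3 := h.flow.mem_omegaLimit h2 t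
  rw [h1] at h3
  exact h3

theorem norm_flow_lt_one (h : DiscFlow φ e p) {x : X} (hx : ‖e x‖ < 1) (t : ℝ) :
    ‖e (φ t x)‖ < 1 := by
  refine lt_of_le_of_ne (h.norm_le _) fun h1 => hx.ne ?_
  rw [← h.flow.neg_apply t x]
  exact h.norm_flow_eq_one h1 _

theorem flow_ne (h : DiscFlow φ e p) {x : X} (hx : x ≠ p) (t : ℝ) : φ t x ≠ p :=
  fun h1 => hx (h.flow.injective t (h1.trans (h.fix_p t).symm))

theorem tendsto_norm (h : DiscFlow φ e p) {x : X} (hx : ‖e x‖ < 1) (hxp : x ≠ p) {ε : ℝ}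
    (hε : 0 < ε) : ∃ N, ∀ t ≥ N, 1 - ε < ‖e (φ t x)‖ := by
  by_contra! hcon
  obtain ⟨y, hy, hy'⟩ := exists_mem_omegaLimit (K := {y | ‖e y‖ ≤ 1 - ε})
    (isClosed_le h.cont.norm continuous_const) hcon
  rw [h.omega x hx hxp] at hy'
  simp only [mem_ofPred_eq] at hy hy'
  linarith

theorem exists_regular (h : DiscFlow φ e p) : ∃ z, ‖e z‖ = 1 ∧ ∃ t, φ t z ≠ z := by
  by_contra! hcon
  have h1 : {z | ‖e z‖ = 1}.Finite := h.fin.subset fun z hz => hcon z hz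
  have h2 : (sphere (0 : ℂ) 1).Finite := by
    refine (h1.image e).subset fun w hw => ?_
    have hw' : ‖w‖ = 1 := by simpa using hw
    obtain ⟨x, rfl⟩ := h.exists_eq hw'.le
    exact ⟨x, hw', rfl⟩
  have h3 : (sphere (0 : ℂ) 1).Infinite := by
    have : Function.Injective fun n : ℕ => (Complex.exp ((((n : ℝ) + 1)⁻¹ : ℝ) * Complex.I)) := by
      intro m n hmn
      have key : ∀ k : ℕ, (Complex.exp ((((k : ℝ) + 1)⁻¹ : ℝ) * Complex.I)).arg
          = ((k : ℝ) + 1)⁻¹ := by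
        intro k
        have h0 : (0 : ℝ) < ((k : ℝ) + 1)⁻¹ := by positivity
        have h1 : ((k : ℝ) + 1)⁻¹ ≤ 1 :=
          inv_le_one_of_one_le₀ (by linarith [k.cast_nonneg (α := ℝ)])
        rw [Complex.arg_exp_mul_I, toIocMod_eq_self]
        constructor <;> linarith [Real.pi_gt_three]
      have := congrArg Complex.arg hmn
      simp only [key, inv_inj, add_left_inj, Nat.cast_inj] at this
      exact this
    refine (infinite_range_of_injective this).mono ?_
    rintro _ ⟨n, rfl⟩
    exact mem_sphere_zero_iff_norm.2 (Complex.norm_exp_ofReal_mul_I _)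
  exact h3 h2

theorem exists_strictMonoOn_arg (h : DiscFlow φ e p) {w : X} (hw : ‖e w‖ = 1)
    (hreg : ∃ t, φ t w ≠ w) {ω : ℂ} (hω : 0 < (e w / ω).re) {τ₀ : ℝ} (hτ₀ : 0 < τ₀) :
    ∃ τ > 0, τ ≤ τ₀ ∧ (∀ t, |t| ≤ τ → 0 < (e (φ t w) / ω).re) ∧
      (StrictMonoOn (fun t => (e (φ t w) / ω).arg) (Icc (-τ) τ) ∨
        StrictAntiOn (fun t => (e (φ t w) / ω).arg) (Icc (-τ) τ)) := by
  have hω0 : ω ≠ 0 := by rintro rfl; simp at hω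
  obtain ⟨u₀, hu₀, hu⟩ := h.flow.exists_no_period hreg
  have hc : Continuous fun t => e (φ t w) / ω :=
    (h.cont.comp (h.flow.continuous₂ continuous_id continuous_const)).div_const _
  have h1 : ∀ᶠ t in 𝓝 (0 : ℝ), 0 < (e (φ t w) / ω).re :=
    (Complex.continuous_re.comp hc).continuousAt.eventually_const_lt (by
      simpa [h.flow.zero] using hω)
  obtain ⟨τ₁, hτ₁, hτ₁'⟩ := Metric.eventually_nhds_iff.1 h1
  have hτ : 0 < min (min τ₀ (τ₁ / 2)) (u₀ / 2) := by positivity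
  refine ⟨min (min τ₀ (τ₁ / 2)) (u₀ / 2), hτ, (min_le_left _ _).trans (min_le_left _ _), ?_⟩
  have l1 : min (min τ₀ (τ₁ / 2)) (u₀ / 2) ≤ τ₁ / 2 := (min_le_left _ _).trans (min_le_right _ _)
  have l2 : min (min τ₀ (τ₁ / 2)) (u₀ / 2) ≤ u₀ / 2 := min_le_right _ _
  set τ := min (min τ₀ (τ₁ / 2)) (u₀ / 2)
  have hpos : ∀ t, |t| ≤ τ → 0 < (e (φ t w) / ω).re := fun t ht => hτ₁' (by
    rw [Real.dist_eq, sub_zero]; linarith)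
  refine ⟨hpos, ContinuousOn.strictMonoOn_of_injOn_Icc' (by linarith) ?_ ?_⟩
  · intro t ht
    exact ((Complex.continuousAt_arg (Or.inl (hpos t (abs_le.2 ht)))).comp
      (f := fun t => e (φ t w) / ω) hc.continuousAt).continuousWithinAt
  · intro s hs t ht hst
    have h2 : e (φ s w) / ω = e (φ t w) / ω := Complex.ext_norm_arg (by
      rw [norm_div, norm_div, h.norm_flow_eq_one hw, h.norm_flow_eq_one hw]) hst
    have h3 : φ s w = φ t w := h.inj ((div_left_inj' hω0).1 h2)
    have := hu (s - t) (abs_le.2 ⟨by linarith [hs.1, ht.2], by linarith [hs.2, ht.1]⟩)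
      (h.flow.sub_eq h3)
    linarith

theorem comp_isometry (h : DiscFlow φ e p) {f : ℂ → ℂ} (hf : Continuous f)
    (hn : ∀ w, ‖f w‖ = ‖w‖) (hb : Function.Bijective f) : DiscFlow φ (f ∘ e) p where
  flow := h.flow
  cont := hf.comp h.cont
  inj := hb.1.comp h.inj
  range_eq := by
    rw [range_comp, h.range_eq]
    ext w
    constructor
    · rintro ⟨v, hv, rfl⟩
      simpa [hn] using hv
    · intro hw
      obtain ⟨v, rfl⟩ := hb.2 w
      exact ⟨v, by simpa [hn] using hw, rfl⟩
  fin := h.fin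
  norm_p := by simpa [hn] using h.norm_p
  fix_p := h.fix_p
  rep := h.rep
  omega := by simpa [hn] using h.omega

theorem exists_normalized (h : DiscFlow φ e p) : ∃ e' : X → ℂ, DiscFlow φ e' p ∧ ∃ z, e' z = 1 ∧
    ∃ τ > 0, τ ≤ 1 / 10 ∧ (∀ t, |t| ≤ τ → 0 < (e' (φ t z)).re) ∧
      StrictMonoOn (fun t => (e' (φ t z)).arg) (Icc (-τ) τ) := by
  obtain ⟨z, hz, hreg⟩ := h.exists_regular
  have hz0 : e z ≠ 0 := by rintro h0; simp [h0] at hz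
  have h1 : DiscFlow φ ((fun w => w / e z) ∘ e) p := h.comp_isometry (by fun_prop)
    (fun w => by simp [hz]) ⟨fun a b hab => (div_left_inj' hz0).1 hab, fun w => ⟨w * e z, by
      simp [hz0]⟩⟩
  obtain ⟨τ, hτ, hτ1, hpos, hm | ha⟩ := h.exists_strictMonoOn_arg hz hreg (ω := e z)
    (by simp [hz0]) (τ₀ := 1 / 10) (by norm_num)
  · exact ⟨_, h1, z, by simp [hz0], τ, hτ, hτ1, hpos, hm⟩
  · refine ⟨_, h1.comp_isometry (f := starRingEnd ℂ) Complex.continuous_conj (by simp)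
      (Function.Involutive.bijective Complex.conj_conj), z, by simp [hz0], τ, hτ, hτ1,
      fun t ht => (Complex.conj_re _).symm ▸ hpos t ht, fun s hs t ht hst => ?_⟩
    have key : ∀ t ∈ Icc (-τ) τ, (starRingEnd ℂ (e (φ t z) / e z)).arg
        = - (e (φ t z) / e z).arg := by
      intro t ht
      rw [Complex.arg_conj, if_neg]
      intro h2
      have := (Complex.abs_arg_lt_pi_div_two_iff.2 (Or.inl (hpos t (abs_le.2 ht))))
      rw [h2, abs_of_pos Real.pi_pos] at this
      linarith [Real.pi_pos]
    have := ha hs ht hst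
    simp only [Function.comp_apply] at *
    rw [key s hs, key t ht]
    linarith

end DiscFlow

/-- A `DiscFlow` whose boundary dynamics near the point `1` turns counterclockwise, with
quantitative control on a neighbourhood of radius `r` over times at most `τ`. -/
structure NormalizedDiscFlow {X : Type*} [MetricSpace X] (φ : ℝ → X → X) (e : X → ℂ) (p : X)
    (τ c r : ℝ) : Prop extends DiscFlow φ e p where
  τ_pos : 0 < τ
  τ_le : τ ≤ 1 / 10
  c_pos : 0 < c
  c_lt : c < 1
  r_pos : 0 < r
  r_lt : r < 1 / 2
  re_pos : ∀ y, ‖e y - 1‖ < r → ∀ t, |t| ≤ τ → 0 < (e (φ t y)).re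
  lt_arg : ∀ y, ‖e y - 1‖ < r → ∀ t ∈ Icc 0 τ, -c < (e (φ t y)).arg
  lt_arg_τ : ∀ y, ‖e y - 1‖ < r → c < (e (φ τ y)).arg
  arg_neg_lt : ∀ y, ‖e y - 1‖ < r → (e (φ (-τ) y)).arg < -c

theorem DiscFlow.exists_normalizedDiscFlow {X : Type*} [MetricSpace X] [CompactSpace X]
    {φ : ℝ → X → X} {e : X → ℂ} {p : X} (h : DiscFlow φ e p) :
    ∃ e' τ c r, NormalizedDiscFlow φ e' p τ c r := by
  obtain ⟨e', h', z, hz, τ, hτ, hτ1, hpos, hm⟩ := h.exists_normalized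
  have m0 : (0 : ℝ) ∈ Icc (-τ) τ := ⟨by linarith, hτ.le⟩
  have mτ : τ ∈ Icc (-τ) τ := ⟨by linarith, le_rfl⟩
  have mτ' : -τ ∈ Icc (-τ) τ := ⟨le_rfl, by linarith⟩
  have a0 : (e' (φ 0 z)).arg = 0 := by rw [h'.flow.zero, hz, Complex.arg_one]
  have a1 : 0 < (e' (φ τ z)).arg := by rw [← a0]; exact hm m0 mτ hτ
  have a2 : (e' (φ (-τ) z)).arg < 0 := by rw [← a0]; exact hm mτ' m0 (by linarith)
  have a3 : ∀ t ∈ Icc 0 τ, 0 ≤ (e' (φ t z)).arg := fun t ht => by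
    rw [← a0]; exact hm.monotoneOn m0 ⟨by linarith [ht.1], ht.2⟩ ht.1
  obtain ⟨c, hc0, hc⟩ : ∃ c > 0, c < min (min (e' (φ τ z)).arg (-(e' (φ (-τ) z)).arg)) 1 :=
    exists_between (by simp [a1, a2])
  simp only [lt_min_iff] at hc
  have hF : Continuous fun x : X × ℝ => e' (φ x.2 x.1) :=
    h'.cont.comp (h'.flow.continuous₂ continuous_snd continuous_fst)
  have hA : ∀ t, |t| ≤ τ → ContinuousAt (fun x : X × ℝ => (e' (φ x.2 x.1)).arg) (z, t) :=
    fun t ht => ContinuousAt.comp (g := Complex.arg) (x := (z, t))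
      (f := fun x : X × ℝ => e' (φ x.2 x.1)) (Complex.continuousAt_arg (Or.inl (hpos t ht)))
      hF.continuousAt
  have hA' : ∀ t, |t| ≤ τ → ContinuousAt (fun x : X => (e' (φ t x)).arg) z := fun t ht =>
    (hA t ht).comp (f := fun x : X => (x, t)) (by fun_prop)
  have E1 : ∀ᶠ y in 𝓝 z, ∀ t ∈ Icc (-τ) τ, 0 < (e' (φ t y)).re :=
    isCompact_Icc.eventually_forall_of_forall_eventually fun t ht =>
      (Complex.continuous_re.comp hF).continuousAt.eventually_const_lt (hpos t (abs_le.2 ht))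
  have E2 : ∀ᶠ y in 𝓝 z, ∀ t ∈ Icc 0 τ, -c < (e' (φ t y)).arg :=
    isCompact_Icc.eventually_forall_of_forall_eventually fun t ht =>
      (hA t (abs_le.2 ⟨by linarith [ht.1], ht.2⟩)).eventually_const_lt (by
        linarith [a3 t ht])
  have E3 : ∀ᶠ y in 𝓝 z, c < (e' (φ τ y)).arg :=
    (hA' τ (abs_le.2 mτ)).eventually_const_lt hc.1.1
  have E4 : ∀ᶠ y in 𝓝 z, (e' (φ (-τ) y)).arg < -c :=
    (hA' (-τ) (abs_le.2 mτ')).eventually_lt_const (by linarith)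
  have E := ((E1.and E2).and (E3.and E4))
  rw [(h'.cont.isClosedEmbedding h'.inj).isInducing.nhds_eq_comap, hz,
    (nhds_basis_ball.comap e').eventually_iff] at E
  obtain ⟨r, hr, hE⟩ := E
  have hE' : ∀ y, ‖e' y - 1‖ < min r (1 / 4) → _ := fun y hy => @hE y (by
    simpa [dist_eq_norm] using hy.trans_le (min_le_left _ _))
  exact ⟨e', τ, c, min r (1 / 4), h', hτ, hτ1, hc0, hc.2, lt_min hr (by norm_num),
    (min_le_right _ _).trans_lt (by norm_num), fun y hy t ht => (hE' y hy).1.1 t (abs_le.1 ht),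
    fun y hy => (hE' y hy).1.2, fun y hy => (hE' y hy).2.1, fun y hy => (hE' y hy).2.2⟩

theorem Complex.exp_eq_norm_of_im {w : ℂ} {n : ℤ} (hw : w.im = 2 * Real.pi * n) :
    Complex.exp w = (‖Complex.exp w‖ : ℂ) := by
  have h1 : w = (w.re : ℂ) + n * (2 * Real.pi * Complex.I) := by
    apply Complex.ext <;> simp [hw]; ring
  rw [Complex.norm_exp, h1, Complex.exp_add, Complex.exp_int_mul_two_pi_mul_I]
  simp

namespace NormalizedDiscFlow

variable {X : Type*} [MetricSpace X] [CompactSpace X] {φ : ℝ → X → X} {e : X → ℂ} {p : X}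
  {τ c r : ℝ}

theorem im_lift_eq (h : NormalizedDiscFlow φ e p τ c r) {y : X} {V : ℝ → ℂ} {S : Set ℝ}
    (hS : S.OrdConnected) (hV : ContinuousOn V S) (hexp : ∀ t ∈ S, Complex.exp (V t) = e (φ t y))
    {t₁ : ℝ} (ht₁ : t₁ ∈ S) (hnear : ‖e (φ t₁ y) - 1‖ < r) {n : ℤ}
    (hn : (V t₁).im = 2 * Real.pi * n + (e (φ t₁ y)).arg) {t : ℝ} (ht : t ∈ S)
    (htt : |t - t₁| ≤ τ) : (V t).im = 2 * Real.pi * n + (e (φ t y)).arg := by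
  have hτ := h.τ_pos
  have hconn : IsPreconnected (S ∩ Icc (t₁ - τ) (t₁ + τ)) :=
    (hS.inter ordConnected_Icc).isPreconnected
  have := hconn.im_eq_arg_exp (hV.mono inter_subset_left) (fun s hs => by
      rw [hexp s hs.1]
      have := h.re_pos _ hnear (s - t₁) (abs_le.2 ⟨by linarith [hs.2.1], by linarith [hs.2.2]⟩)
      rwa [h.flow.add, sub_add_cancel] at this) (a := t₁)
    ⟨ht₁, by constructor <;> linarith⟩ (by rw [hexp t₁ ht₁]; exact hn)
    (x := t) ⟨ht, by obtain ⟨h1, h2⟩ := abs_le.1 htt; constructor <;> linarith⟩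
  rwa [hexp t ht] at this

theorem lt_im_lift (h : NormalizedDiscFlow φ e p τ c r) {y : X} {V : ℝ → ℂ} {S : Set ℝ}
    (hS : S.OrdConnected) (hV : ContinuousOn V S) (hexp : ∀ t ∈ S, Complex.exp (V t) = e (φ t y))
    (hr : ∀ t ∈ S, 1 - r < ‖e (φ t y)‖) {n : ℤ} {t₁ t₂ : ℝ} (ht₁ : t₁ ∈ S) (ht₂ : t₂ ∈ S)
    (ht : t₁ ≤ t₂) (hn : 2 * Real.pi * n ≤ (V t₁).im) : 2 * Real.pi * n - c < (V t₂).im := by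
  have hτ := h.τ_pos
  have hc := h.c_pos
  have hsub : Icc t₁ t₂ ⊆ S := hS.out ht₁ ht₂
  have hVc : ContinuousOn (fun t => (V t).im) (Icc t₁ t₂) :=
    Complex.continuous_im.comp_continuousOn (hV.mono hsub)
  by_contra! hcon
  have hK : IsCompact (Icc t₁ t₂ ∩ (fun t => (V t).im) ⁻¹' Ici (2 * Real.pi * n)) :=
    isCompact_Icc.of_isClosed_subset (hVc.preimage_isClosed_of_isClosed isClosed_Icc isClosed_Ici)
      inter_subset_left
  obtain ⟨t₃, ht₃, hmax⟩ := hK.exists_isGreatest ⟨t₁, left_mem_Icc.2 ht, hn⟩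
  have ht₃S := hsub ht₃.1
  have him : (V t₃).im = 2 * Real.pi * n := by
    obtain ⟨s, hs, hs'⟩ := intermediate_value_Icc' ht₃.1.2 (hVc.mono (Icc_subset_Icc_left ht₃.1.1))
      (show 2 * Real.pi * n ∈ Icc (V t₂).im (V t₃).im from ⟨by linarith, ht₃.2⟩)
    have h1 : s ≤ t₃ := hmax ⟨⟨ht₃.1.1.trans hs.1, hs.2⟩, hs'.ge⟩
    rw [← hs', le_antisymm hs.1 h1]
  have hreal := Complex.exp_eq_norm_of_im him
  rw [hexp t₃ ht₃S] at hreal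
  have hnear : ‖e (φ t₃ y) - 1‖ < r := by
    rw [hreal, ← Complex.ofReal_one, ← Complex.ofReal_sub, Complex.norm_real, Real.norm_eq_abs,
      abs_sub_lt_iff]
    constructor <;> linarith [hr t₃ ht₃S, h.norm_le (φ t₃ y), h.r_pos]
  have harg : (V t₃).im = 2 * Real.pi * n + (e (φ t₃ y)).arg := by
    rw [him, hreal, Complex.arg_ofReal_of_nonneg (norm_nonneg _), add_zero]
  rcases le_or_gt t₂ (t₃ + τ) with h1 | h1
  · have h2 := h.im_lift_eq hS hV hexp ht₃S hnear harg ht₂ (abs_le.2 ⟨by linarith [ht₃.1.2],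
      by linarith⟩)
    have h3 := h.lt_arg _ hnear (t₂ - t₃) ⟨by linarith [ht₃.1.2], by linarith⟩
    rw [h.flow.add, sub_add_cancel] at h3
    linarith
  · have h4 : t₃ + τ ∈ Icc t₁ t₂ := ⟨by linarith [ht₃.1.1], h1.le⟩
    have h2 := h.im_lift_eq hS hV hexp ht₃S hnear harg (hsub h4) (abs_le.2 ⟨by linarith,
      by linarith⟩)
    have h3 := h.lt_arg_τ _ hnear
    rw [h.flow.add, add_comm τ] at h3
    have h5 : t₃ + τ ≤ t₃ := hmax ⟨h4, by
      simp only [mem_preimage, mem_Ici]; linarith⟩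
    linarith

theorem exists_visit (h : NormalizedDiscFlow φ e p τ c r) {x : X} (hx : ‖e x‖ < 1) (hxp : x ≠ p)
    {w : ℂ} (hw : ‖w‖ = 1) {η : ℝ} (hη : 0 < η) (N : ℝ) : ∃ t ≥ N, ‖e (φ t x) - w‖ < η := by
  obtain ⟨z, hz⟩ := h.exists_eq (w := w) hw.le
  have hω : z ∈ OmegaLimit φ x := by
    rw [h.omega x hx hxp]
    simp [hz, hw]
  obtain ⟨ε, hε, hε'⟩ := Metric.continuous_iff.1 h.cont z η hη
  obtain ⟨t, ht, ht'⟩ := exists_near_of_mem_omegaLimit hω hε N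
  refine ⟨t, ht, ?_⟩
  have := hε' _ ht'
  rwa [dist_eq_norm, hz] at this

theorem exists_le_im_lift (h : NormalizedDiscFlow φ e p τ c r) {x : X} (hx : ‖e x‖ < 1)
    (hxp : x ≠ p) {V : ℝ → ℂ} {α : ℝ} (hV : ContinuousOn V (Ici α))
    (hexp : ∀ t ∈ Ici α, Complex.exp (V t) = e (φ t x))
    (hr : ∀ t ∈ Ici α, 1 - r < ‖e (φ t x)‖) (K : ℝ) : ∃ S ≥ α, ∀ t ≥ S, K ≤ (V t).im := by
  have hτ := h.τ_pos
  have hc := h.c_pos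
  have hpi := Real.pi_pos
  have key : ∀ N : ℕ, ∃ u ≥ α, 2 * Real.pi * (⌊(V α).im / (2 * Real.pi)⌋ + N : ℤ) ≤ (V u).im := by
    intro N
    induction N with
    | zero =>
      refine ⟨α, le_rfl, ?_⟩
      have := Int.floor_le ((V α).im / (2 * Real.pi))
      rw [le_div_iff₀ (by positivity)] at this
      simpa [mul_comm] using this
    | succ N ih =>
      obtain ⟨u, hu, hN⟩ := ih
      set n := ⌊(V α).im / (2 * Real.pi)⌋ + N
      obtain ⟨u', hu', hnear⟩ := h.exists_visit hx hxp (w := 1) (by simp) h.r_pos (u + τ)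
      have hu'S : u' ∈ Ici α := by simp only [mem_Ici]; linarith
      have hmS : u' - τ ∈ Ici α := by simp only [mem_Ici]; linarith
      have hpS : u' + τ ∈ Ici α := by simp only [mem_Ici]; linarith
      obtain ⟨m, hm⟩ := Complex.exists_im_eq_arg_exp (V u')
      rw [hexp u' hu'S] at hm
      have h1 := h.im_lift_eq ordConnected_Ici hV hexp hu'S hnear hm hmS
        (by rw [abs_of_nonpos] <;> linarith)
      have h2 := h.im_lift_eq ordConnected_Ici hV hexp hu'S hnear hm hpS
        (by rw [abs_of_nonneg] <;> linarith)
      have h3 := h.arg_neg_lt _ hnear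
      rw [h.flow.add, neg_add_eq_sub] at h3
      have h4 := h.lt_arg_τ _ hnear
      rw [h.flow.add, add_comm τ] at h4
      have h5 := h.lt_im_lift ordConnected_Ici hV hexp hr hu hmS (by linarith) hN
      have h6 : n < m := by
        have : (n : ℝ) < m := by
          by_contra! h7; nlinarith
        exact_mod_cast this
      refine ⟨u' + τ, hpS, ?_⟩
      have h8 : ((n : ℝ) + 1) ≤ m := by exact_mod_cast h6
      have h9 : ((⌊(V α).im / (2 * Real.pi)⌋ + (N + 1 : ℕ) : ℤ) : ℝ) = n + 1 := by
        simp only [n]; push_cast; ring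
      rw [h9]
      nlinarith
  obtain ⟨N, hN⟩ := exists_nat_ge ((K + c) / (2 * Real.pi) - ⌊(V α).im / (2 * Real.pi)⌋)
  obtain ⟨u, hu, hu'⟩ := key N
  refine ⟨u, hu, fun t ht => ?_⟩
  have h1 := h.lt_im_lift ordConnected_Ici hV hexp hr hu (mem_Ici.2 (hu.le.trans ht)) ht hu'
  rw [sub_le_iff_le_add, div_le_iff₀ (by positivity)] at hN
  push_cast at h1
  linarith

theorem stable_boundary (h : NormalizedDiscFlow φ e p τ c r) {ε : ℝ} (hε : 0 < ε) :
    ∃ δ > 0, ∀ y, 1 - δ < ‖e y‖ → ∀ t ≥ 0, 1 - ε < ‖e (φ t y)‖ := by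
  have hτ := h.τ_pos
  have hc := h.c_pos
  have hpi := Real.pi_pos
  have hr2 := h.r_lt
  wlog hεr : ε < r generalizing ε
  · obtain ⟨δ, hδ, h1⟩ := this (ε := r / 2) (half_pos h.r_pos) (half_lt_self h.r_pos)
    exact ⟨δ, hδ, fun y hy t ht => by linarith [h1 y hy t ht, h.r_pos]⟩
  obtain ⟨x₀, hx₀, hx₀p⟩ := h.exists_interior
  obtain ⟨N, hN⟩ := h.tendsto_norm hx₀ hx₀p hε
  obtain ⟨x, hxdef⟩ : ∃ x, x = φ N x₀ := ⟨_, rfl⟩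
  have hx : ‖e x‖ < 1 := hxdef ▸ h.norm_flow_lt_one hx₀ N
  have hxp : x ≠ p := hxdef ▸ h.flow_ne hx₀p N
  have hxε : ∀ t ≥ 0, 1 - ε < ‖e (φ t x)‖ := fun t ht => by
    rw [hxdef, h.flow.add]; exact hN _ (by linarith)
  obtain ⟨Vx, hVx, hVx', -⟩ := exists_log_lift (A := Unit) (fun q => e (φ (max q.1 0) x))
    ((h.continuous_orbit x).comp (by fun_prop)) (fun q hq => by
      have := hxε (max q.1 0) (le_max_right _ _)
      rw [hq, norm_zero] at this; linarith) (fun _ => Complex.log (e x)) continuous_const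
    (fun _ => by
      rw [max_self, h.flow.zero, Complex.exp_log]
      intro h0
      have := hxε 0 le_rfl
      rw [h.flow.zero, h0, norm_zero] at this; linarith)
  obtain ⟨V, hVdef⟩ : ∃ V : ℝ → ℂ, V = fun t => Vx (t, ()) := ⟨_, rfl⟩
  have hV : Continuous V := by rw [hVdef]; fun_prop
  have hVe : ∀ t ∈ Ici (0 : ℝ), Complex.exp (V t) = e (φ t x) := fun t ht => by
    rw [hVdef, hVx', max_eq_left ht]
  have hgrow := h.exists_le_im_lift hx hxp (α := 0) hV.continuousOn hVe
    (fun t ht => by linarith [hxε t ht])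
  obtain ⟨n₀, hn₀⟩ : ∃ n : ℤ, (V 0).im + 1 ≤ 2 * Real.pi * n := by
    obtain ⟨n, hn⟩ := exists_nat_ge (((V 0).im + 1) / (2 * Real.pi))
    rw [div_le_iff₀ (by positivity)] at hn
    exact ⟨n, by push_cast; linarith⟩
  obtain ⟨S, hS, hS'⟩ := hgrow (2 * Real.pi * n₀ + 2 * Real.pi)
  obtain ⟨s₀, hs₀, hmax⟩ := isCompact_Icc.exists_isMaxOn (nonempty_Icc.2 hS)
    (h.continuous_orbit x).norm.continuousOn
  have hM : ‖e (φ s₀ x)‖ < 1 := h.norm_flow_lt_one hx s₀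
  refine ⟨min ε (1 - ‖e (φ s₀ x)‖), lt_min hε (by linarith), fun y hy => ?_⟩
  by_contra! hcon
  obtain ⟨t₁, ht₁, ht₁'⟩ := hcon
  have hyε : 1 - ε < ‖e y‖ := by linarith [min_le_left ε (1 - ‖e (φ s₀ x)‖)]
  have hyM : ‖e (φ s₀ x)‖ < ‖e y‖ := by linarith [min_le_right ε (1 - ‖e (φ s₀ x)‖)]
  have hK : IsCompact (Icc 0 t₁ ∩ (fun t => ‖e (φ t y)‖) ⁻¹' Iic (1 - ε)) :=
    isCompact_Icc.inter_right (isClosed_Iic.preimage (h.continuous_orbit y).norm)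
  obtain ⟨T, hT, hTmin⟩ := hK.exists_isLeast ⟨t₁, right_mem_Icc.2 ht₁, ht₁'⟩
  have hTε : ‖e (φ T y)‖ = 1 - ε := by
    obtain ⟨s, hs, hs'⟩ := intermediate_value_Icc' hT.1.1
      (h.continuous_orbit y).norm.continuousOn
      (show 1 - ε ∈ Icc ‖e (φ T y)‖ ‖e (φ 0 y)‖ from ⟨hT.2, by rw [h.flow.zero]; exact hyε.le⟩)
    have h1 : T ≤ s := hTmin ⟨⟨hs.1, hs.2.trans hT.1.2⟩, hs'.le⟩
    rw [le_antisymm h1 hs.2]; exact hs'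
  have hbelow : ∀ t ∈ Icc 0 T, 1 - ε ≤ ‖e (φ t y)‖ := by
    intro t ht
    by_contra! hlt
    have := hTmin ⟨⟨ht.1, ht.2.trans hT.1.2⟩, hlt.le⟩
    rw [le_antisymm ht.2 this] at hlt
    linarith
  have hy0 : e y ≠ 0 := by rintro h0; rw [h0, norm_zero] at hyε; linarith
  obtain ⟨k, hk1, hk2⟩ : ∃ k : ℤ, 2 * Real.pi * n₀ ≤ (e y).arg + 2 * Real.pi * k ∧
      (e y).arg + 2 * Real.pi * k < 2 * Real.pi * n₀ + 2 * Real.pi := by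
    have h1 := Complex.neg_pi_lt_arg (e y)
    have h2 := Complex.arg_le_pi (e y)
    rcases le_or_gt 0 (e y).arg with h3 | h3
    · exact ⟨n₀, by linarith, by linarith⟩
    · exact ⟨n₀ + 1, by push_cast; linarith, by push_cast; linarith⟩
  obtain ⟨Vy, hVy, hVy', hVy0⟩ := exists_log_lift (A := Unit)
    (fun q => e (φ (projIcc 0 T hT.1.1 q.1) y))
    ((h.continuous_orbit y).comp (by fun_prop)) (fun q hq => by
      have := hbelow _ (projIcc 0 T hT.1.1 q.1).2
      rw [hq, norm_zero] at this; linarith)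
    (fun _ => Complex.log (e y) + k * (2 * Real.pi * Complex.I)) continuous_const
    (fun _ => by
      rw [Complex.exp_add, Complex.exp_log hy0, Complex.exp_int_mul_two_pi_mul_I, mul_one,
        projIcc_left]
      simp [h.flow.zero])
  obtain ⟨U, hUdef⟩ : ∃ U : ℝ → ℂ, U = fun t => Vy (t, ()) := ⟨_, rfl⟩
  have hU : Continuous U := by rw [hUdef]; fun_prop
  have hUe : ∀ t ∈ Icc 0 T, Complex.exp (U t) = e (φ t y) := fun t ht => by
    rw [hUdef, hVy', projIcc_of_mem _ ht]
  have hU0 : (U 0).im = (e y).arg + 2 * Real.pi * k := by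
    rw [hUdef]; simp only [hVy0]; simp [Complex.log_im]; ring
  have m0 : (0 : ℝ) ∈ Icc 0 T := left_mem_Icc.2 hT.1.1
  have mT : T ∈ Icc 0 T := right_mem_Icc.2 hT.1.1
  have hUlow : ∀ t ∈ Icc 0 T, (V 0).im < (U t).im := fun t ht => by
    have := h.lt_im_lift ordConnected_Icc hU.continuousOn hUe
      (fun t ht => by linarith [hbelow t ht]) (n := n₀) m0 ht ht.1 (by rw [hU0]; exact hk1)
    linarith [h.c_lt]
  obtain ⟨s₁, hs₁, hmax₁⟩ := isCompact_Icc.exists_isMaxOn (nonempty_Icc.2 hT.1.1)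
    (Complex.continuous_im.comp hU).continuousOn
  obtain ⟨S₂, hS₂, hS₂'⟩ := hgrow ((U s₁).im + 1)
  have hreU0 : (U 0).re ≤ 0 := by
    rw [Complex.re_eq_log_norm_exp, hUe 0 m0, h.flow.zero]
    exact Real.log_nonpos (norm_nonneg _) (h.norm_le y)
  have hreV : ∀ s ≥ 0, (V s).re = Real.log ‖e (φ s x)‖ := fun s hs => by
    rw [Complex.re_eq_log_norm_exp, hVe s hs]
  have hVneg : ∀ s ≥ 0, (V s).re < 0 := fun s hs => by
    rw [hreV s hs]
    exact Real.log_neg (by linarith [hxε s hs]) (h.norm_flow_lt_one hx s)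
  have hmaxT : ∀ t ∈ Icc (-1) T, max t 0 ∈ Icc 0 T := fun t ht =>
    ⟨le_max_right _ _, max_le ht.2 hT.1.1⟩
  obtain ⟨s, hs, t, ht, hst⟩ := exists_zero_of_signs
    (F := fun q => V q.1 - (U (max q.2 0) + ((min q.2 0 * (U 0).re : ℝ) : ℂ)))
    (by fun_prop) (a := 0) (b := S₂) (c := -1) (d := T) hS₂ (by linarith [hT.1.1])
    (fun s hs => by simpa using hVneg s hs.1)
    (fun s hs => by
      have h1 : (U T).re = Real.log (1 - ε) := by
        rw [Complex.re_eq_log_norm_exp, hUe T mT, hTε]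
      have h2 := Real.log_lt_log (by linarith) (hxε s hs.1)
      simp only [max_eq_left hT.1.1, min_eq_right hT.1.1, zero_mul, Complex.ofReal_zero, add_zero,
        Complex.sub_re, h1, hreV s hs.1]
      linarith)
    (fun t ht => by
      have := hUlow _ (hmaxT t ht)
      simp only [Complex.sub_im, Complex.add_im, Complex.ofReal_im]; linarith)
    (fun t ht => by
      have h1 := hmax₁ (hmaxT t ht)
      have h2 := hS₂' S₂ le_rfl
      simp only [mem_ofPred_eq, Function.comp_apply] at h1
      simp only [Complex.sub_im, Complex.add_im, Complex.ofReal_im]; linarith)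
  rw [sub_eq_zero] at hst
  rcases lt_or_ge t 0 with h0 | h0
  · rw [max_eq_right h0.le, min_eq_left h0.le] at hst
    have h1 := congrArg Complex.im hst
    have h2 := congrArg Complex.re hst
    simp only [Complex.add_im, Complex.ofReal_im, Complex.add_re, Complex.ofReal_re] at h1 h2
    have h3 : s ≤ S := by
      by_contra! h4
      have := hS' s h4.le
      linarith
    have h5 : (U 0).re ≤ (V s).re := by rw [h2]; nlinarith
    rw [hreV s hs.1, Complex.re_eq_log_norm_exp, hUe 0 m0, h.flow.zero,
      Real.log_le_log_iff (norm_pos_iff.2 hy0) (by linarith [hxε s hs.1])] at h5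
    have h6 := hmax ⟨hs.1, h3⟩
    simp only [mem_ofPred_eq] at h6
    linarith
  · rw [max_eq_left h0, min_eq_right h0, zero_mul, Complex.ofReal_zero, add_zero] at hst
    have h1 := congrArg Complex.exp hst
    rw [hVe s hs.1, hUe t ⟨h0, ht.2⟩] at h1
    have h2 := congrArg (φ (T - t)) (h.inj h1)
    rw [h.flow.add, h.flow.add, sub_add_cancel] at h2
    have h3 := hxε (T - t + s) (by linarith [ht.2, hs.1])
    rw [h2, hTε] at h3
    linarith

end NormalizedDiscFlow

theorem IsFlow.reverse {X : Type*} [MetricSpace X] {φ : ℝ → X → X} (h : IsFlow φ) :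
    IsFlow fun t x => φ (-t) x :=
  ⟨h.continuous₂ (by fun_prop) continuous_snd, fun x => by simp [h.zero], fun s t x => by
    simp only [h.add, neg_add]⟩

namespace NormalizedDiscFlow

variable {X : Type*} [MetricSpace X] [CompactSpace X] {φ : ℝ → X → X} {e : X → ℂ} {p : X}
  {τ c r : ℝ}

theorem exists_near_repeller (h : NormalizedDiscFlow φ e p τ c r) {x : X} (hx : ‖e x‖ < 1)
    {η : ℝ} (hη : 0 < η) : ∃ t ≤ 0, dist (φ t x) p < η := by
  obtain ⟨δ, hδ, hst⟩ := h.stable_boundary (ε := 1 - ‖e x‖) (by linarith)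
  have hback : ∀ t ≥ 0, ‖e (φ (-t) x)‖ ≤ 1 - δ := by
    intro t ht
    by_contra! hlt
    have := hst _ hlt t ht
    rw [h.flow.apply_neg] at this
    linarith
  have hcl : IsClosed {y | ‖e y‖ ≤ 1 - δ} := isClosed_le h.cont.norm continuous_const
  obtain ⟨y, hyK, hy⟩ := exists_mem_omegaLimit (φ := fun t x => φ (-t) x) (x := x) hcl
    (fun N => ⟨max N 0, le_max_left _ _, hback _ (le_max_right _ _)⟩)
  have hyp : y = p := by
    by_contra hyp
    have hy1 : ‖e y‖ < 1 := by simp only [mem_ofPred_eq] at hyK; linarith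
    obtain ⟨N, hN⟩ := h.tendsto_norm hy1 hyp hδ
    obtain ⟨u, hu, hu'⟩ := h.flow.reverse.mem_omegaLimit hy (-N)
    rw [neg_neg] at hu'
    have : φ N y ∈ {y | ‖e y‖ ≤ 1 - δ} := hcl.mem_of_tendsto hu'
      ((hu.eventually_ge_atTop 0).mono fun k hk => hback _ hk)
    simp only [mem_ofPred_eq] at this
    linarith [hN N le_rfl]
  rw [hyp] at hy
  obtain ⟨t, ht, ht'⟩ := exists_near_of_mem_omegaLimit hy hη 0
  exact ⟨-t, by linarith, ht'⟩

theorem exists_collar (h : NormalizedDiscFlow φ e p τ c r) {U : Set X} (hU : IsOpen U)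
    (hB : ∀ y, ‖e y‖ = 1 → y ∈ U) : ∃ δ > 0, ∀ y, 1 - δ < ‖e y‖ → y ∈ U := by
  rcases (Uᶜ).eq_empty_or_nonempty with h0 | h0
  · exact ⟨1, one_pos, fun y _ => by rw [compl_empty_iff] at h0; rw [h0]; trivial⟩
  · obtain ⟨x, hx, hmax⟩ := hU.isClosed_compl.isCompact.exists_isMaxOn h0 h.cont.norm.continuousOn
    have hx1 : ‖e x‖ < 1 := lt_of_le_of_ne (h.norm_le x) fun h1 => hx (hB x h1)
    refine ⟨1 - ‖e x‖, by linarith, fun y hy => ?_⟩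
    by_contra hyU
    have := hmax hyU
    simp only [mem_ofPred_eq] at this
    linarith

theorem exists_time_function (h : NormalizedDiscFlow φ e p τ c r) {ρ : ℝ} (hρ : 0 < ρ) :
    ∃ T : X → ℝ, ContinuousOn T {x | ‖e x‖ < 1 ∧ x ≠ p} ∧
      (∀ x, ‖e x‖ < 1 → x ≠ p → ∀ t, T (φ t x) = T x + t) ∧
      (∀ K : ℝ, ∃ δ > 0, ∀ y, ‖e y‖ < 1 → y ≠ p → 1 - δ < ‖e y‖ → K ≤ T y) ∧
      (∀ K : ℝ, ∃ δ > 0, ∀ y, ‖e y‖ < 1 → y ≠ p → dist y p < δ → T y ≤ K) ∧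
      ∀ y, ‖e y‖ < 1 → y ≠ p → -1 ≤ T y → 1 - ρ < ‖e y‖ := by
  have hWo : IsOpen {x | ‖e x‖ < 1 ∧ x ≠ p} :=
    (isOpen_lt h.cont.norm continuous_const).inter isOpen_ne
  obtain ⟨m, hm0, hm1⟩ := exists_between h.norm_p
  obtain ⟨r₀, hr₀, hr₀'⟩ := Metric.eventually_nhds_iff.1
    (h.cont.norm.continuousAt.eventually_lt_const hm0)
  obtain ⟨δ₁', hδ₁', hst₁'⟩ := h.rep.1 r₀ hr₀
  obtain ⟨δ₁, hδ₁, hst₁⟩ : ∃ δ₁ > 0, ∀ x t, t ≤ 0 → dist x p < δ₁ → dist (φ t x) p < r₀ :=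
    ⟨δ₁', hδ₁', fun x t ht hx => by simpa using hst₁' x hx (-t) (by linarith)⟩
  obtain ⟨δ₂, hδ₂, hst₂⟩ : ∃ δ₂ > 0, ∀ x t, t ≤ 0 → dist x p < δ₂ → dist (φ t x) p < δ₁ / 2 := by
    obtain ⟨δ₂, hδ₂, hst₂⟩ := h.rep.1 (δ₁ / 2) (half_pos hδ₁)
    exact ⟨δ₂, hδ₂, fun x t ht hx => by simpa using hst₂ x hx (-t) (by linarith)⟩
  obtain ⟨v, hv, hv0, hv1, hvnn, hvle⟩ : ∃ v : X → ℝ, Continuous v ∧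
      (∀ x, dist x p < δ₁ / 2 → v x = 0) ∧ (∀ x, δ₁ ≤ dist x p → v x = 1) ∧
      (∀ x, 0 ≤ v x) ∧ ∀ x, v x ≤ 1 := by
    refine ⟨fun x => max 0 (min 1 (2 * dist x p / δ₁ - 1)), by fun_prop, fun x hx => ?_,
      fun x hx => ?_, fun x => le_max_left _ _, fun x => max_le zero_le_one (min_le_left _ _)⟩
    · apply max_eq_left
      apply (min_le_right _ _).trans
      rw [sub_nonpos, div_le_one hδ₁]; linarith
    · have h1 : 1 ≤ 2 * dist x p / δ₁ - 1 := by
        rw [le_sub_iff_add_le, le_div_iff₀ hδ₁]; linarith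
      simp only [min_eq_left h1]; exact max_eq_right zero_le_one
  have hvc : ∀ x, Continuous fun t => v (φ t x) := fun x =>
    hv.comp (h.flow.continuous₂ continuous_id continuous_const)
  have hvi : ∀ x a b, IntervalIntegrable (fun t => v (φ t x)) MeasureTheory.volume a b :=
    fun x a b => (hvc x).intervalIntegrable a b
  have hlow : ∀ x a, dist (φ a x) p < δ₂ → ∀ t ≤ a, v (φ t x) = 0 := by
    intro x a ha t ht
    apply hv0
    have := hst₂ _ (t - a) (by linarith) ha
    rwa [h.flow.add, sub_add_cancel] at this
  have hhigh : ∀ x b, m < ‖e (φ b x)‖ → ∀ t ≥ b, v (φ t x) = 1 := by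
    intro x b hb t ht
    apply hv1
    by_contra! hlt
    have := hst₁ _ (b - t) (by linarith) hlt
    rw [h.flow.add, sub_add_cancel] at this
    linarith [hr₀' this]
  have hexa : ∀ x, ‖e x‖ < 1 → x ≠ p → ∃ a ≤ 0, dist (φ a x) p < δ₂ :=
    fun x hx _ => h.exists_near_repeller hx hδ₂
  have hexb : ∀ x, ‖e x‖ < 1 → x ≠ p → ∃ b ≥ 0, m < ‖e (φ b x)‖ := by
    intro x hx hxp
    obtain ⟨N, hN⟩ := h.tendsto_norm hx hxp (ε := 1 - m) (by linarith)
    exact ⟨max N 0, le_max_right _ _, by linarith [hN _ (le_max_left N 0)]⟩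
  have hindep : ∀ x a b a' b', (∀ t ≤ a, v (φ t x) = 0) → (∀ t ≤ a', v (φ t x) = 0) →
      (∀ t ≥ b, v (φ t x) = 1) → (∀ t ≥ b', v (φ t x) = 1) →
      (∫ s in a..b, v (φ s x)) - b = (∫ s in a'..b', v (φ s x)) - b' := by
    intro x a b a' b' ha ha' hb hb'
    have h1 : ∫ s in a..a', v (φ s x) = 0 := by
      rw [intervalIntegral.integral_congr (g := fun _ => (0 : ℝ))]
      · simp
      · intro t ht
        rcases le_total a a' with hh | hh
        · rw [uIcc_of_le hh] at ht; exact ha' t ht.2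
        · rw [uIcc_of_ge hh] at ht; exact ha t ht.2
    have h2 : ∫ s in b'..b, v (φ s x) = b - b' := by
      rw [intervalIntegral.integral_congr (g := fun _ => (1 : ℝ))]
      · simp
      · intro t ht
        rcases le_total b' b with hh | hh
        · rw [uIcc_of_le hh] at ht; exact hb' t ht.1
        · rw [uIcc_of_ge hh] at ht; exact hb t ht.1
    rw [← intervalIntegral.integral_add_adjacent_intervals (hvi x a a') (hvi x a' b),
      ← intervalIntegral.integral_add_adjacent_intervals (hvi x a' b') (hvi x b' b), h1, h2]
    ring
  obtain ⟨T, hT⟩ : ∃ T : X → ℝ, ∀ x, ‖e x‖ < 1 → x ≠ p → ∀ a b, (∀ t ≤ a, v (φ t x) = 0) →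
      (∀ t ≥ b, v (φ t x) = 1) → T x = (∫ s in a..b, v (φ s x)) - b := by
    choose! a _ ha using hexa
    choose! b _ hb using hexb
    exact ⟨fun x => (∫ s in (a x)..(b x), v (φ s x)) - b x, fun x hx hxp a' b' ha' hb' =>
      hindep _ _ _ _ _ (hlow x _ (ha x hx hxp)) ha' (hhigh x _ (hb x hx hxp)) hb'⟩
  have hTc : ∀ x, ‖e x‖ < 1 → x ≠ p → ContinuousAt T x := by
    intro x hx hxp
    obtain ⟨a, -, ha⟩ := hexa x hx hxp
    obtain ⟨b, -, hb⟩ := hexb x hx hxp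
    have hc : Continuous fun y => (∫ s in a..b, v (φ s y)) - b :=
      (intervalIntegral.continuous_parametric_intervalIntegral_of_continuous'
        (f := fun y s => v (φ s y)) (hv.comp (h.flow.continuous₂ continuous_snd continuous_fst))
        a b).sub continuous_const
    refine hc.continuousAt.congr ?_
    have e1 : ∀ᶠ y in 𝓝 x, dist (φ a y) p < δ₂ :=
      ((h.flow.continuous₂ continuous_const continuous_id).dist
        continuous_const).continuousAt.eventually_lt_const ha
    have e2 : ∀ᶠ y in 𝓝 x, m < ‖e (φ b y)‖ :=
      (h.cont.comp (h.flow.continuous₂ continuous_const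
        continuous_id)).norm.continuousAt.eventually_const_lt hb
    filter_upwards [e1, e2, hWo.mem_nhds ⟨hx, hxp⟩] with y hy1 hy2 hy3
    exact (hT y hy3.1 hy3.2 a b (hlow y a hy1) (hhigh y b hy2)).symm
  have hTadd : ∀ x, ‖e x‖ < 1 → x ≠ p → ∀ t, T (φ t x) = T x + t := by
    intro x hx hxp t
    obtain ⟨a, -, ha⟩ := hexa x hx hxp
    obtain ⟨b, -, hb⟩ := hexb x hx hxp
    have ha' := hlow x a ha
    have hb' := hhigh x b hb
    rw [hT x hx hxp a b ha' hb', hT (φ t x) (h.norm_flow_lt_one hx t) (h.flow_ne hxp t)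
      (a - t) (b - t) (fun s hs => by rw [h.flow.add]; exact ha' _ (by linarith))
      (fun s hs => by rw [h.flow.add]; exact hb' _ (by linarith))]
    simp_rw [h.flow.add]
    rw [intervalIntegral.integral_comp_add_right (fun s => v (φ s x)), sub_add_cancel,
      sub_add_cancel]
    ring
  have hTtop : ∀ K : ℝ, ∃ δ > 0, ∀ y, ‖e y‖ < 1 → y ≠ p → 1 - δ < ‖e y‖ → K ≤ T y := by
    intro K
    obtain ⟨δ, hδ, hst⟩ := h.stable_boundary (ε := 1 - m) (by linarith)
    obtain ⟨δ', hδ', hcol⟩ := h.exists_collar (U := {y | 1 - δ < ‖e (φ (-K) y)‖})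
      (isOpen_lt continuous_const (h.cont.comp (h.flow.continuous₂ continuous_const
        continuous_id)).norm) (fun y hy => by
        simp only [mem_ofPred_eq]; rw [h.norm_flow_eq_one hy]; linarith)
    refine ⟨δ', hδ', fun y hy hyp hyn => ?_⟩
    have hy1 := h.norm_flow_lt_one hy (-K)
    have hy2 := h.flow_ne hyp (-K)
    have hv' : ∀ t ≥ 0, v (φ t (φ (-K) y)) = 1 := hhigh _ 0 (by
      have := hst _ (hcol y hyn) 0 le_rfl
      linarith)
    obtain ⟨a, ha0, ha⟩ := hexa _ hy1 hy2
    have h1 := hT _ hy1 hy2 a 0 (hlow _ a ha) hv'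
    have h2 : 0 ≤ ∫ s in a..0, v (φ s (φ (-K) y)) :=
      intervalIntegral.integral_nonneg ha0 fun s _ => hvnn _
    have h3 := hTadd y hy hyp (-K)
    linarith
  have hTbot : ∀ K : ℝ, ∃ δ > 0, ∀ y, ‖e y‖ < 1 → y ≠ p → dist y p < δ → T y ≤ K := by
    intro K
    have e1 : ∀ᶠ y in 𝓝 p, dist (φ (-K) y) p < δ₂ :=
      ((h.flow.continuous₂ continuous_const continuous_id).dist
        continuous_const).continuousAt.eventually_lt_const (by simpa [h.fix_p] using hδ₂)
    obtain ⟨δ, hδ, hδ'⟩ := Metric.eventually_nhds_iff.1 e1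
    refine ⟨δ, hδ, fun y hy hyp hyd => ?_⟩
    obtain ⟨b, -, hb⟩ := hexb y hy hyp
    have hb' : ∀ t ≥ max b (-K), v (φ t y) = 1 := fun t ht =>
      hhigh y b hb t ((le_max_left _ _).trans ht)
    have h1 := hT y hy hyp (-K) (max b (-K)) (hlow y _ (hδ' hyd)) hb'
    have h2 : ∫ s in (-K)..(max b (-K)), v (φ s y) ≤ ∫ s in (-K)..(max b (-K)), 1 :=
      intervalIntegral.integral_mono_on (le_max_right _ _) (hvi _ _ _)
        (by simp) fun s _ => hvle _
    simp only [intervalIntegral.integral_const, smul_eq_mul, mul_one] at h2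
    linarith
  obtain ⟨M, hM⟩ : ∃ M, ∀ y, ‖e y‖ < 1 → y ≠ p → ‖e y‖ ≤ 1 - ρ → T y ≤ M := by
    obtain ⟨δ, hδ, hδ'⟩ := hTbot 0
    have hK : IsCompact {y | ‖e y‖ ≤ 1 - ρ ∧ δ ≤ dist y p} :=
      ((isClosed_le h.cont.norm continuous_const).inter
        (isClosed_le continuous_const (continuous_id.dist continuous_const))).isCompact
    obtain ⟨M, hM⟩ := hK.bddAbove_image (f := T) fun y hy =>
      (hTc y (by linarith [hy.1]) (by
        rintro rfl
        have := hy.2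
        rw [dist_self] at this; linarith)).continuousWithinAt
    refine ⟨max M 0, fun y hy hyp hyρ => ?_⟩
    rcases lt_or_ge (dist y p) δ with h1 | h1
    · exact (hδ' y hy hyp h1).trans (le_max_right _ _)
    · exact (hM ⟨y, ⟨hyρ, h1⟩, rfl⟩).trans (le_max_left _ _)
  refine ⟨fun x => T x - (M + 2), fun x hx => ((hTc x hx.1 hx.2).sub
    continuousAt_const).continuousWithinAt, fun x hx hxp t => by simp only [hTadd x hx hxp]; ring,
    fun K => ?_, fun K => ?_, fun y hy hyp hyT => ?_⟩
  · obtain ⟨δ, hδ, hδ'⟩ := hTtop (K + (M + 2))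
    exact ⟨δ, hδ, fun y hy hyp hyd => by linarith [hδ' y hy hyp hyd]⟩
  · obtain ⟨δ, hδ, hδ'⟩ := hTbot (K + (M + 2))
    exact ⟨δ, hδ, fun y hy hyp hyd => by linarith [hδ' y hy hyp hyd]⟩
  · by_contra! hle
    linarith [hM y hy hyp hle]

end NormalizedDiscFlow

theorem IsFlow.exists_timeChange {X : Type*} [MetricSpace X] {φ : ℝ → X → X} (hφ : IsFlow φ)
    {ρ : X → ℝ} (hρ : Continuous ρ) (hρ1 : ∀ x, 1 / 2 ≤ ρ x) :
    ∃ (ψ : ℝ → X → X) (h : ℝ → X → ℝ), IsTimeChange φ ψ ∧ (∀ t x, ψ t x = φ (h t x) x) ∧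
      Continuous (fun q : ℝ × X => h q.1 q.2) ∧ (∀ t x, ∫ s in (0 : ℝ)..(h t x), ρ (φ s x) = t) ∧
      (∀ t x, h (∫ s in (0 : ℝ)..t, ρ (φ s x)) x = t) ∧ (∀ x, StrictMono fun t => h t x) ∧
      ∀ s t x, |h s x - h t x| ≤ 2 * |s - t| := by
  have hi : ∀ x a b, IntervalIntegrable (fun s => ρ (φ s x)) MeasureTheory.volume a b :=
    fun x a b => (hρ.comp (hφ.continuous₂ continuous_id continuous_const)).intervalIntegrable a b
  obtain ⟨θ, hθ⟩ : ∃ θ : ℝ → X → ℝ, ∀ t x, θ t x = ∫ s in (0 : ℝ)..t, ρ (φ s x) :=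
    ⟨_, fun _ _ => rfl⟩
  have hsub : ∀ s t x, θ t x - θ s x = ∫ u in s..t, ρ (φ u x) := fun s t x => by
    rw [hθ, hθ, intervalIntegral.integral_interval_sub_left (hi _ _ _) (hi _ _ _)]
  have hgrow : ∀ s t x, s ≤ t → (t - s) / 2 ≤ θ t x - θ s x := by
    intro s t x hst
    rw [hsub]
    have := intervalIntegral.integral_mono_on hst (f := fun _ => (1 / 2 : ℝ)) (by simp) (hi x s t)
      fun u _ => hρ1 _
    simp only [intervalIntegral.integral_const, smul_eq_mul] at this
    linarith
  have habs : ∀ s t x, |t - s| ≤ 2 * |θ t x - θ s x| := by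
    intro s t x
    rcases le_total s t with hst | hst
    · have := hgrow s t x hst
      rw [abs_of_nonneg (by linarith), abs_of_nonneg (by linarith)]; linarith
    · have := hgrow t s x hst
      rw [abs_of_nonpos (by linarith), abs_of_nonpos (by linarith)]; linarith
  have hθ0 : ∀ x, θ 0 x = 0 := fun x => by rw [hθ]; simp
  have hmono : ∀ x, StrictMono fun t => θ t x := fun x s t hst => by
    have := hgrow s t x hst.le
    simp only; linarith
  have hθc : Continuous fun q : ℝ × X => θ q.1 q.2 := by
    simp_rw [hθ]
    exact intervalIntegral.continuous_parametric_intervalIntegral_of_continuous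
      (f := fun (q : ℝ × X) s => ρ (φ s q.2))
      (hρ.comp (hφ.continuous₂ continuous_snd (continuous_snd.comp continuous_fst)))
      continuous_fst
  have hsurj : ∀ x, Function.Surjective fun t => θ t x := by
    intro x
    refine Continuous.surjective (hθc.comp (by fun_prop : Continuous fun t : ℝ => (t, x))) ?_ ?_
    · refine tendsto_atTop_mono' atTop (f₁ := fun t => t / 2) ?_
        (tendsto_id.atTop_div_const (zero_lt_two' ℝ))
      filter_upwards [eventually_ge_atTop 0] with t ht
      have := hgrow 0 t x ht
      rw [hθ0] at this; linarith
    · refine tendsto_atBot_mono' atBot (f₁ := fun t => t / 2) ?_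
        (tendsto_id.atBot_div_const (zero_lt_two' ℝ))
      filter_upwards [eventually_le_atBot 0] with t ht
      have := hgrow t 0 x ht
      rw [hθ0] at this; linarith
  choose g hg using hsurj
  simp only at hg
  obtain ⟨h, hh⟩ : ∃ h : ℝ → X → ℝ, ∀ t x, θ (h t x) x = t := ⟨fun t x => g x t, fun t x => hg x t⟩
  have hh' : ∀ t x, h (θ t x) x = t := fun t x => (hmono x).injective (hh _ x)
  have hlip : ∀ s t x, |h s x - h t x| ≤ 2 * |s - t| := fun s t x => by
    have := habs (h t x) (h s x) x
    rwa [hh, hh] at this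
  have hc : Continuous fun q : ℝ × X => h q.1 q.2 := by
    rw [continuous_iff_continuousAt]
    rintro ⟨t₀, x₀⟩
    rw [ContinuousAt, tendsto_iff_dist_tendsto_zero]
    have h1 : Continuous fun q : ℝ × X => 2 * |q.1 - θ (h t₀ x₀) q.2| :=
      continuous_const.mul ((continuous_fst.sub (hθc.comp
        (continuous_const.prodMk continuous_snd))).abs)
    have h2 := h1.tendsto (t₀, x₀)
    simp only [hh, sub_self, abs_zero, mul_zero] at h2
    refine squeeze_zero (fun _ => dist_nonneg) (fun q => ?_) h2
    have := habs (h t₀ x₀) (h q.1 q.2) q.2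
    rwa [hh] at this
  have hmono' : ∀ x, StrictMono fun t => h t x := fun x s t hst => by
    by_contra! hle
    have := (hmono x).monotone hle
    simp only [hh] at this
    linarith
  have hcoc : ∀ s t x, h (s + t) x = h s (φ (h t x) x) + h t x := by
    intro s t x
    apply (hmono x).injective
    have h1 := hsub (h t x) (h s (φ (h t x) x) + h t x) x
    have h2 : θ (h s (φ (h t x) x)) (φ (h t x) x) = s := hh _ _
    rw [hθ] at h2
    simp_rw [hφ.add] at h2
    rw [intervalIntegral.integral_comp_add_right (fun u => ρ (φ u x)), zero_add] at h2
    simp only [hh]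
    rw [h2, hh] at h1
    linarith
  refine ⟨fun t x => φ (h t x) x, h, ⟨⟨hφ.continuous₂ hc continuous_snd, fun x => ?_,
    fun s t x => ?_⟩, h, hc, fun x => ?_, hmono', fun x t => ⟨θ t x, hh' t x⟩, fun t x => rfl⟩,
    fun _ _ => rfl, hc, fun t x => by rw [← hθ, hh], fun t x => by rw [← hθ, hh'], hmono', hlip⟩
  · have := hh' 0 x
    rw [hθ0] at this
    simp only [this, hφ.zero]
  · simp only [hφ.add, hcoc]
  · have := hh' 0 x
    rwa [hθ0] at this

namespace DiscFlow

variable {X : Type*} [MetricSpace X] [CompactSpace X] {φ : ℝ → X → X} {e : X → ℂ} {p : X}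

theorem continuousAt_arg_div (h : DiscFlow φ e p) {w : X} {ω : ℂ} (hω : 0 < (e w / ω).re) :
    ContinuousAt (fun y => (e y / ω).arg) w :=
  ContinuousAt.comp (g := Complex.arg) (f := fun y => e y / ω)
    (Complex.continuousAt_arg (Or.inl hω)) (h.cont.div_const _).continuousAt

theorem eq_of_arg_div (h : DiscFlow φ e p) {x y : X} (hx : ‖e x‖ = 1) (hy : ‖e y‖ = 1) {ω : ℂ}
    (hω : ω ≠ 0) (hxy : (e x / ω).arg = (e y / ω).arg) : x = y :=
  h.inj ((div_left_inj' hω).1 (Complex.ext_norm_arg (by rw [norm_div, norm_div, hx, hy]) hxy))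

theorem ne_zero_of_norm_eq_one {w : X} (hw : ‖e w‖ = 1) : e w ≠ 0 := by
  intro h0
  simp [h0] at hw

theorem exists_flow_box (h : DiscFlow φ e p) {w : X} (hw : ‖e w‖ = 1) (hreg : ∃ t, φ t w ≠ w)
    {ε : ℝ} (hε : 0 < ε) :
    ∃ V, IsOpen V ∧ w ∈ V ∧ ∀ y ∈ V, ‖e y‖ = 1 → ∃ t, |t| ≤ ε ∧ y = φ t w := by
  have hw0 := ne_zero_of_norm_eq_one hw
  have hre : 0 < (e w / e w).re := by simp [hw0]
  obtain ⟨τ, hτ, hτε, hpos, hm⟩ := h.exists_strictMonoOn_arg hw hreg hre hε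
  have hcont : ContinuousOn (fun t => (e (φ t w) / e w).arg) (Icc (-τ) τ) := fun t ht =>
    (ContinuousAt.comp (g := Complex.arg) (f := fun t => e (φ t w) / e w)
      (Complex.continuousAt_arg (Or.inl (hpos t (abs_le.2 ht))))
      ((h.continuous_orbit w).div_const _).continuousAt).continuousWithinAt
  have a0 : (e (φ 0 w) / e w).arg = 0 := by rw [h.flow.zero, div_self hw0, Complex.arg_one]
  have m0 : (0 : ℝ) ∈ Icc (-τ) τ := ⟨by linarith, hτ.le⟩
  have mτ : τ ∈ Icc (-τ) τ := ⟨by linarith, le_rfl⟩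
  have mτ' : -τ ∈ Icc (-τ) τ := ⟨le_rfl, by linarith⟩
  have hca := h.continuousAt_arg_div hre
  have key : ∀ᶠ y in 𝓝 w, ‖e y‖ = 1 → ∃ t, |t| ≤ ε ∧ y = φ t w := by
    have fin : ∀ y, ‖e y‖ = 1 →
        (e y / e w).arg ∈ (fun t => (e (φ t w) / e w).arg) '' Icc (-τ) τ →
        ∃ t, |t| ≤ ε ∧ y = φ t w := by
      rintro y hy ⟨t, ht, hty⟩
      exact ⟨t, (abs_le.2 ht).trans hτε,
        (h.eq_of_arg_div (h.norm_flow_eq_one hw t) hy hw0 hty).symm⟩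
    have hww : (e w / e w).arg = 0 := by rw [div_self hw0, Complex.arg_one]
    rcases hm with hm | hm
    · have h1 := hm mτ' m0 (by linarith)
      have h2 := hm m0 mτ hτ
      simp only [a0] at h1 h2
      filter_upwards [hca.eventually_const_lt (hww.symm ▸ h1),
        hca.eventually_lt_const (hww.symm ▸ h2)] with y hy1 hy2 hy
      exact fin y hy (intermediate_value_Icc (by linarith) hcont ⟨hy1.le, hy2.le⟩)
    · have h1 := hm mτ' m0 (by linarith)
      have h2 := hm m0 mτ hτ
      simp only [a0] at h1 h2
      filter_upwards [hca.eventually_lt_const (hww.symm ▸ h1),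
        hca.eventually_const_lt (hww.symm ▸ h2)] with y hy1 hy2 hy
      exact fin y hy (intermediate_value_Icc' (by linarith) hcont ⟨hy2.le, hy1.le⟩)
  obtain ⟨V, hV, hVo, hwV⟩ := _root_.eventually_nhds_iff.1 key
  exact ⟨V, hVo, hwV, hV⟩

theorem eq_of_forall_dist_le (h : DiscFlow φ e p) {q : X} (hq1 : ‖e q‖ = 1) {g : ℝ}
    (hg : ∀ y, dist y q ≤ g → 0 < (e y / e q).re)
    (hfix : ∀ y, dist y q ≤ g → (∀ t, φ t y = y) → y = q) {x : X} (hx : ‖e x‖ = 1)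
    (hxq : ∀ t, dist (φ t x) q ≤ g) : x = q := by
  have hq0 := ne_zero_of_norm_eq_one hq1
  let Y : Set X := {y | ‖e y‖ = 1} ∩ ⋂ t, {y | dist (φ t y) q ≤ g}
  have hY : IsClosed Y := (isClosed_eq h.cont.norm continuous_const).inter
    (isClosed_iInter fun t => isClosed_le ((h.flow.continuous₂ continuous_const
      continuous_id).dist continuous_const) continuous_const)
  have hYd : ∀ y ∈ Y, ∀ t, dist (φ t y) q ≤ g := fun y hy t => mem_iInter.1 hy.2 t
  have hYq : ∀ y ∈ Y, dist y q ≤ g := fun y hy => by simpa [h.flow.zero] using hYd y hy 0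
  have hYinv : ∀ y ∈ Y, ∀ t, φ t y ∈ Y := fun y hy t =>
    ⟨h.norm_flow_eq_one hy.1 t, mem_iInter.2 fun s => by
      simp only [mem_ofPred_eq, h.flow.add]; exact hYd y hy _⟩
  have hc : ContinuousOn (fun y => (e y / e q).arg) Y := fun y hy =>
    (h.continuousAt_arg_div (hg y (hYq y hy))).continuousWithinAt
  have hxY : x ∈ Y := ⟨hx, mem_iInter.2 hxq⟩
  have reg : ∀ y ∈ Y, y ≠ q → (∃ z ∈ Y, (e y / e q).arg < (e z / e q).arg) ∧
      ∃ z ∈ Y, (e z / e q).arg < (e y / e q).arg := by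
    intro y hy hyq
    have hreg : ∃ t, φ t y ≠ y := by
      by_contra! hcon
      exact hyq (hfix y (hYq y hy) hcon)
    obtain ⟨τ, hτ, -, -, hm⟩ := h.exists_strictMonoOn_arg hy.1 hreg (hg y (hYq y hy)) one_pos
    have m0 : (0 : ℝ) ∈ Icc (-τ) τ := ⟨by linarith, hτ.le⟩
    have mτ : τ ∈ Icc (-τ) τ := ⟨by linarith, le_rfl⟩
    have mτ' : -τ ∈ Icc (-τ) τ := ⟨le_rfl, by linarith⟩
    rcases hm with hm | hm
    · have h1 := hm mτ' m0 (by linarith)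
      have h2 := hm m0 mτ hτ
      simp only [h.flow.zero] at h1 h2
      exact ⟨⟨_, hYinv y hy τ, h2⟩, ⟨_, hYinv y hy (-τ), h1⟩⟩
    · have h1 := hm mτ' m0 (by linarith)
      have h2 := hm m0 mτ hτ
      simp only [h.flow.zero] at h1 h2
      exact ⟨⟨_, hYinv y hy (-τ), h1⟩, ⟨_, hYinv y hy τ, h2⟩⟩
  obtain ⟨a, ha, hmax⟩ := hY.isCompact.exists_isMaxOn ⟨x, hxY⟩ hc
  obtain ⟨b, hb, hmin⟩ := hY.isCompact.exists_isMinOn ⟨x, hxY⟩ hc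
  have haq : a = q := by
    by_contra hne
    obtain ⟨z, hz, hz'⟩ := (reg a ha hne).1
    exact (hmax hz).not_gt hz'
  have hbq : b = q := by
    by_contra hne
    obtain ⟨z, hz, hz'⟩ := (reg b hb hne).2
    exact (hmin hz).not_gt hz'
  rw [haq] at hmax
  rw [hbq] at hmin
  exact h.eq_of_arg_div hx hq1 hq0 (le_antisymm (hmax hxY) (hmin hxY))

theorem exists_isolating_radius (h : DiscFlow φ e p) : ∃ g > 0,
    (∀ q q', (∀ t, φ t q = q) → (∀ t, φ t q' = q') → q' ≠ q → 2 * g < dist q' q) ∧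
    ∀ q, (∀ t, φ t q = q) → ‖e q‖ = 1 → ∀ y, dist y q ≤ g → 0 < (e y / e q).re := by
  have key : ∀ᶠ g in 𝓝[>] (0 : ℝ), (∀ q ∈ {q | ∀ t, φ t q = q}, ∀ q' ∈ {q | ∀ t, φ t q = q},
      q' ≠ q → 2 * g < dist q' q) ∧
      ∀ q ∈ {q | ∀ t, φ t q = q}, ‖e q‖ = 1 → ∀ y, dist y q ≤ g → 0 < (e y / e q).re := by
    refine Eventually.and ((eventually_all_finite h.fin).2 fun q hq =>
      (eventually_all_finite h.fin).2 fun q' hq' => ?_) ((eventually_all_finite h.fin).2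
        fun q hq => ?_)
    · by_cases hne : q' = q
      · simp [hne]
      · have hd : 0 < dist q' q := dist_pos.2 hne
        filter_upwards [Ioo_mem_nhdsGT (half_pos hd)] with g hg _
        linarith [hg.2]
    · by_cases hq1 : ‖e q‖ = 1
      · have hq0 := ne_zero_of_norm_eq_one hq1
        obtain ⟨g₀, hg₀, hg⟩ := Metric.eventually_nhds_iff.1
          ((Complex.continuous_re.comp (h.cont.div_const (e q))).continuousAt.eventually_const_lt
            (show (0 : ℝ) < (e q / e q).re by simp [hq0]))
        filter_upwards [Ioo_mem_nhdsGT hg₀] with g hg' _ y hy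
        exact hg (hy.trans_lt hg'.2)
      · simp [hq1]
  obtain ⟨g, hg, hg0⟩ := (key.and self_mem_nhdsWithin).exists
  exact ⟨g, hg0, fun q q' hq hq' => hg.1 q hq q' hq', hg.2⟩

theorem exists_far_from_fixed (h : DiscFlow φ e p) {g : ℝ}
    (hsep : ∀ q q', (∀ t, φ t q = q) → (∀ t, φ t q' = q') → q' ≠ q → 2 * g < dist q' q)
    (hre : ∀ q, (∀ t, φ t q = q) → ‖e q‖ = 1 → ∀ y, dist y q ≤ g → 0 < (e y / e q).re)
    (hg : 0 < g) {x : X} (hx : ‖e x‖ = 1) (hreg : ∃ t, φ t x ≠ x) :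
    ∃ t, ∀ q, (∀ t, φ t q = q) → ‖e q‖ = 1 → g ≤ dist (φ t x) q := by
  by_contra! hcon
  obtain ⟨q, hq, hq1, hq0⟩ := hcon 0
  have hsub : range (fun t => φ t x) ⊆ ball q g := by
    refine IsPreconnected.subset_left_of_subset_union isOpen_ball
      (v := ⋃ q' ∈ {q' | (∀ t, φ t q' = q') ∧ q' ≠ q}, ball q' g)
      (isOpen_biUnion fun _ _ => isOpen_ball) ?_ ?_ ⟨_, mem_range_self 0, hq0⟩
      (isPreconnected_range (h.flow.continuous₂ continuous_id continuous_const))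
    · rw [disjoint_iUnion₂_right]
      rintro q' ⟨hq', hne⟩
      apply ball_disjoint_ball
      have := hsep q q' hq hq' hne
      rw [dist_comm] at this
      linarith
    · rintro _ ⟨t, rfl⟩
      obtain ⟨q', hq', -, ht⟩ := hcon t
      by_cases hne : q' = q
      · left; rw [← hne]; exact ht
      · right; exact mem_biUnion (x := q') ⟨hq', hne⟩ ht
  have hxq := h.eq_of_forall_dist_le hq1 (hre q hq hq1) (fun y hy hfy => by
    by_contra hne
    have := hsep q y hq hfy hne
    linarith) hx fun t => (hsub (mem_range_self t) : dist (φ t x) q < g).le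
  obtain ⟨t, ht⟩ := hreg
  exact ht (hxq ▸ hq t)

theorem expansive_boundary (h : DiscFlow φ e p) {ε : ℝ} (hε : 0 < ε) :
    ∃ δ > 0, ∀ x y, ‖e x‖ = 1 → ‖e y‖ = 1 → (∀ t, dist (φ t x) (φ t y) < δ) →
      ∃ s, |s| < ε ∧ y = φ s x := by
  obtain ⟨g, hg, hsep, hre⟩ := h.exists_isolating_radius
  let K : Set X := {y | ‖e y‖ = 1 ∧ ∀ q, (∀ t, φ t q = q) → ‖e q‖ = 1 → g ≤ dist y q}
  have hK : IsCompact K := by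
    apply IsClosed.isCompact
    have : K = {y | ‖e y‖ = 1} ∩ ⋂ q : {q // (∀ t, φ t q = q) ∧ ‖e q‖ = 1},
        {y | g ≤ dist y q.1} := by
      ext y; simp [K]
    rw [this]
    exact (isClosed_eq h.cont.norm continuous_const).inter
      (isClosed_iInter fun q => isClosed_le continuous_const (by fun_prop))
  have hKreg : ∀ w ∈ K, ∃ t, φ t w ≠ w := by
    rintro w ⟨hw, hw'⟩
    by_contra! hcon
    have := hw' w hcon hw
    simp only [dist_self] at this
    linarith
  choose! V hVo hwV hV using fun w (hw : w ∈ K) =>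
    h.exists_flow_box hw.1 (hKreg w hw) (ε := ε / 3) (by linarith)
  obtain ⟨δ, hδ, hleb⟩ := lebesgue_number_lemma_of_metric (c := fun w : K => V w.1) hK
    (fun w => hVo w.1 w.2) fun w hw => mem_iUnion.2 ⟨⟨w, hw⟩, hwV w hw⟩
  refine ⟨min δ g, by positivity, fun x y hx hy hxy => ?_⟩
  by_cases hreg : ∃ t, φ t x ≠ x
  · obtain ⟨t, ht⟩ := h.exists_far_from_fixed hsep hre hg hx hreg
    obtain ⟨w, hw⟩ := hleb (φ t x) ⟨h.norm_flow_eq_one hx t, ht⟩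
    obtain ⟨a, ha, hxa⟩ := hV w.1 w.2 _ (hw (mem_ball_self hδ)) (h.norm_flow_eq_one hx t)
    obtain ⟨b, hb, hyb⟩ := hV w.1 w.2 _ (hw (show dist (φ t y) (φ t x) < δ by
      rw [dist_comm]; exact (hxy t).trans_le (min_le_left _ _))) (h.norm_flow_eq_one hy t)
    refine ⟨b - a, ?_, h.flow.injective t ?_⟩
    · rw [abs_le] at ha hb
      rw [abs_lt]
      constructor <;> linarith [ha.1, ha.2, hb.1, hb.2]
    · rw [hyb, h.flow.add, add_comm, ← h.flow.add, hxa, h.flow.add, sub_add_cancel]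
  · push Not at hreg
    have : y = x := h.eq_of_forall_dist_le hx (hre x hreg hx) (fun z hz hfz => by
      by_contra hne
      have := hsep x z hreg hfz hne
      linarith) hy fun t => by
        have := hxy t
        rw [hreg t, dist_comm] at this
        exact (this.trans_le (min_le_right _ _)).le
    exact ⟨0, by simpa using hε, by rw [h.flow.zero, this]⟩

end DiscFlow

/-- Distance at least `1 / 10` from every real number congruent to `i / 5` modulo `1`. -/
def FarFromShift (i : Fin 5) (t : ℝ) : Prop :=
  ∀ n : ℤ, 1 / 10 ≤ |t - i / 5 - n|

theorem isClosed_farFromShift (i : Fin 5) : IsClosed {t | FarFromShift i t} := by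
  simp only [FarFromShift, Set.ofPred_forall]
  exact isClosed_iInter fun n => isClosed_le continuous_const (by fun_prop)

theorem FarFromShift.eventually_floor_eq {i : Fin 5} {t : ℝ} (h : FarFromShift i t) :
    ∀ᶠ s : ℝ in 𝓝 t, ⌊s - (i : ℝ) / 5⌋ = ⌊t - (i : ℝ) / 5⌋ := by
  have h1 : (⌊t - (i : ℝ) / 5⌋ : ℝ) < t - i / 5 := by
    refine lt_of_le_of_ne (Int.floor_le _) fun h2 => ?_
    have := h ⌊t - (i : ℝ) / 5⌋
    rw [h2, sub_self, abs_zero] at this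
    norm_num at this
  have h2 := Int.lt_floor_add_one (t - i / 5 : ℝ)
  have hc : Continuous fun s : ℝ => s - i / 5 := by fun_prop
  filter_upwards [hc.continuousAt.eventually_const_lt h1,
    hc.continuousAt.eventually_lt_const h2] with s hs1 hs2
  exact Int.floor_eq_iff.2 ⟨hs1.le, hs2⟩

theorem eq_of_not_farFromShift {i j : Fin 5} {t : ℝ} (hi : ¬ FarFromShift i t)
    (hj : ¬ FarFromShift j t) : i = j := by
  simp only [FarFromShift, not_forall, not_le] at hi hj
  obtain ⟨n, hn⟩ := hi
  obtain ⟨m, hm⟩ := hj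
  rw [abs_lt] at hn hm
  have h1 : ((i : ℕ) + 5 * n : ℝ) - ((j : ℕ) + 5 * m) < 1 := by linarith [hn.1, hm.2]
  have h2 : ((j : ℕ) + 5 * m : ℝ) - ((i : ℕ) + 5 * n) < 1 := by linarith [hn.2, hm.1]
  have h3 : ((i : ℕ) : ℤ) + 5 * n - ((j : ℕ) + 5 * m) < 1 := by exact_mod_cast h1
  have h4 : ((j : ℕ) : ℤ) + 5 * m - ((i : ℕ) + 5 * n) < 1 := by exact_mod_cast h2
  have := i.2
  have := j.2
  ext
  omega

theorem exists_forall_farFromShift (t : Fin 4 → ℝ) : ∃ i, ∀ j, FarFromShift i (t j) := by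
  by_contra! hcon
  choose j hj using hcon
  obtain ⟨a, b, hab, hj'⟩ := Fintype.exists_ne_map_eq_of_card_lt j (by simp)
  exact hab (eq_of_not_farFromShift (hj a) (hj' ▸ hj b))

theorem exists_pos_dist_lt_of_injective {X : Type*} [MetricSpace X] [CompactSpace X] {e : X → ℂ}
    (he : Continuous e) (hinj : Function.Injective e) {ε : ℝ} (hε : 0 < ε) :
    ∃ μ > 0, ∀ x y, ‖e x - e y‖ < μ → dist x y < ε := by
  have hK : IsCompact {q : X × X | ε ≤ dist q.1 q.2} :=
    (isClosed_le continuous_const (by fun_prop)).isCompact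
  obtain ⟨μ, hμ, hle⟩ := hK.exists_forall_le' (f := fun q : X × X => ‖e q.1 - e q.2‖)
    (Continuous.continuousOn (by fun_prop)) (a := 0) (fun q hq => by
      rw [norm_pos_iff, sub_ne_zero]
      intro h
      simp only [mem_ofPred_eq, hinj h, dist_self] at hq
      linarith)
  refine ⟨μ, hμ, fun x y hxy => ?_⟩
  by_contra! hcon
  exact (hle (x, y) hcon).not_gt hxy

theorem exists_phase_functions {X : Type*} [MetricSpace X] [CompactSpace X] {e : X → ℂ}
    (he : Continuous e) (hinj : Function.Injective e) {Q : Set X} (hQ : IsClosed Q)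
    (Near : Fin 5 → X → ℝ → Prop) (hNear : ∀ i, ∀ y ∈ Q, ∃ a, ∀ᶠ x in 𝓝[Q] y, Near i x a)
    {f : X → ℝ} (hf : Continuous f) (hf0 : ∀ x, 0 ≤ f x) (hf1 : ∀ x, f x ≤ 1) :
    ∃ A : Fin 5 → X → ℝ, (∀ i, Continuous (A i)) ∧ (∀ i x, |A i x| ≤ 3) ∧
      ∀ x ∈ Q, ∀ y ∈ Q, ∃ i, (∃ (a : ℝ) (m : ℤ), Near i x a ∧ a + A i x = 3 * m + f x) ∧
        ∃ (a : ℝ) (m : ℤ), Near i y a ∧ a + A i y = 3 * m + f y := by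
  have hleb : ∀ i, ∃ ε > 0, ∀ y ∈ Q, ∃ a, ∀ x ∈ Q, dist x y < ε → Near i x a := by
    intro i
    choose! a ha using hNear i
    have ha' : ∀ y ∈ Q, ∃ U, IsOpen U ∧ y ∈ U ∧ ∀ x ∈ U ∩ Q, Near i x (a y) := fun y hy => by
      obtain ⟨U, hUo, hyU, hU⟩ := mem_nhdsWithin.1 (ha y hy)
      exact ⟨U, hUo, hyU, hU⟩
    choose! U hUo hyU hU using ha'
    obtain ⟨ε, hε, hε'⟩ := lebesgue_number_lemma_of_metric (c := fun w : Q => U w.1) hQ.isCompact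
      (fun w => hUo w.1 w.2) fun w hw => mem_iUnion.2 ⟨⟨w, hw⟩, hyU w hw⟩
    refine ⟨ε, hε, fun y hy => ?_⟩
    obtain ⟨w, hw⟩ := hε' y hy
    exact ⟨a w, fun x hx hxy => hU w.1 w.2 x ⟨hw hxy, hx⟩⟩
  obtain ⟨ε, hε, hε'⟩ : ∃ ε > 0, ∀ i, ∀ y ∈ Q, ∃ a, ∀ x ∈ Q, dist x y < ε → Near i x a := by
    choose ε hε hε' using hleb
    obtain ⟨i₀, hi₀⟩ := Finite.exists_min ε
    refine ⟨ε i₀, hε i₀, fun i y hy => ?_⟩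
    obtain ⟨a, ha⟩ := hε' i y hy
    exact ⟨a, fun x hx hxy => ha x hx (hxy.trans_le (hi₀ i))⟩
  obtain ⟨μ', hμ', hμ2⟩ := exists_pos_dist_lt_of_injective he hinj hε
  obtain ⟨μ, hμ, rfl⟩ : ∃ μ > 0, μ' = 2 * μ := ⟨μ' / 2, by positivity, by ring⟩
  let G : Fin 5 → Set X := fun i =>
    {x | FarFromShift i ((e x).re / μ)} ∩ {x | FarFromShift i ((e x).im / μ)}
  have hre : Continuous fun x => (e x).re / μ := (Complex.continuous_re.comp he).div_const _
  have him : Continuous fun x => (e x).im / μ := (Complex.continuous_im.comp he).div_const _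
  have hG : ∀ i, IsClosed (G i) := fun i =>
    ((isClosed_farFromShift i).preimage hre).inter ((isClosed_farFromShift i).preimage him)
  let tile : Fin 5 → X → ℤ × ℤ := fun i x =>
    (⌊(e x).re / μ - i / 5⌋, ⌊(e x).im / μ - i / 5⌋)
  have htile : ∀ i x y, tile i x = tile i y → dist x y < ε := by
    intro i x y hxy
    apply hμ2
    have h1 := Int.abs_sub_lt_one_of_floor_eq_floor (congrArg Prod.fst hxy)
    have h2 := Int.abs_sub_lt_one_of_floor_eq_floor (congrArg Prod.snd hxy)
    rw [sub_sub_sub_cancel_right, ← sub_div, abs_div, abs_of_pos hμ, div_lt_one hμ] at h1 h2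
    have h3 := Complex.norm_le_abs_re_add_abs_im (e x - e y)
    rw [Complex.sub_re, Complex.sub_im] at h3
    linarith
  have hloc : ∀ i, ∀ x ∈ G i, ∀ᶠ y in 𝓝 x, tile i y = tile i x := by
    intro i x hx
    filter_upwards [hre.continuousAt.eventually hx.1.eventually_floor_eq,
      him.continuousAt.eventually hx.2.eventually_floor_eq] with y h1 h2
    exact Prod.ext h1 h2
  have hA : ∀ i, ∃ A : X → ℝ, Continuous A ∧ (∀ x, |A x| ≤ 3) ∧
      ∀ x ∈ Q ∩ G i, ∃ (a : ℝ) (m : ℤ), Near i x a ∧ a + A x = 3 * m + f x := by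
    intro i
    have hrep : ∀ q : ℤ × ℤ, ∃ a, ∀ x ∈ Q, tile i x = q → Near i x a := by
      intro q
      by_cases hq : ∃ y ∈ Q, tile i y = q
      · obtain ⟨y, hy, rfl⟩ := hq
        obtain ⟨a, ha⟩ := hε' i y hy
        exact ⟨a, fun x hx hxy => ha x hx (htile i x y hxy)⟩
      · push Not at hq
        exact ⟨0, fun x hx hxq => absurd hxq (hq x hx)⟩
    choose a ha using hrep
    have hg : Continuous fun x : ↥(Q ∩ G i) =>
        a (tile i x) - 3 * (⌊a (tile i x) / 3⌋ : ℝ) := by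
      refine continuous_iff_continuousAt.2 fun x => ?_
      refine (continuousAt_const (y := a (tile i x) - 3 * (⌊a (tile i x) / 3⌋ : ℝ))).congr ?_
      filter_upwards [continuous_subtype_val.continuousAt.eventually (hloc i x x.2.2)] with y hy
      rw [hy]
    obtain ⟨g, hgmem, hgr⟩ := ContinuousMap.exists_restrict_eq_forall_mem_of_closed
      (s := Q ∩ G i) ⟨_, hg⟩ (t := Icc (0 : ℝ) 3) (fun x => by
        have h1 := Int.floor_le (a (tile i x) / 3)
        have h2 := Int.lt_floor_add_one (a (tile i x) / 3)
        simp only [ContinuousMap.coe_mk]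
        constructor <;> linarith) ⟨0, by norm_num, by norm_num⟩ (hQ.inter (hG i))
    refine ⟨fun x => f x - g x, hf.sub g.continuous, fun x => ?_, fun x hx => ?_⟩
    · have := hgmem x
      rw [abs_le]
      constructor <;> linarith [this.1, this.2, hf0 x, hf1 x]
    · refine ⟨a (tile i x), ⌊a (tile i x) / 3⌋, ha _ x hx.1 rfl, ?_⟩
      have := congrArg (fun k => k ⟨x, hx⟩) hgr
      simp only [ContinuousMap.restrict_apply, ContinuousMap.coe_mk] at this
      simp only [this]
      ring
  choose A hAc hAb hA' using hA
  refine ⟨A, hAc, hAb, fun x hx y hy => ?_⟩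
  obtain ⟨i, hi⟩ := exists_forall_farFromShift
    ![(e x).re / μ, (e x).im / μ, (e y).re / μ, (e y).im / μ]
  exact ⟨i, hA' i x ⟨hx, hi 0, hi 1⟩, hA' i y ⟨hy, hi 2, hi 3⟩⟩

/-- A normalized disc flow with a time function `T` on the punctured open disc, whose values
exceed `-1` only close to the boundary circle. -/
structure SectionedDiscFlow {X : Type*} [MetricSpace X] (φ : ℝ → X → X) (e : X → ℂ) (p : X)
    (τ c r : ℝ) (T : X → ℝ) (η : ℝ) : Prop extends NormalizedDiscFlow φ e p τ c r where
  η_pos : 0 < η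
  η_lt : η < 1
  norm_exp_sub_one_lt : ∀ w : ℂ, |w.re| < η → ∀ n : ℤ, |w.im - 2 * Real.pi * n| < η →
    ‖Complex.exp w - 1‖ < r
  contOn : ContinuousOn T {x | ‖e x‖ < 1 ∧ x ≠ p}
  time_flow : ∀ x, ‖e x‖ < 1 → x ≠ p → ∀ t, T (φ t x) = T x + t
  le_time : ∀ K : ℝ, ∃ δ > 0, ∀ y, ‖e y‖ < 1 → y ≠ p → 1 - δ < ‖e y‖ → K ≤ T y
  time_le : ∀ K : ℝ, ∃ δ > 0, ∀ y, ‖e y‖ < 1 → y ≠ p → dist y p < δ → T y ≤ K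
  lt_norm : ∀ y, ‖e y‖ < 1 → y ≠ p → -1 ≤ T y → 1 - r < ‖e y‖
  abs_log_lt : ∀ y, ‖e y‖ < 1 → y ≠ p → -1 ≤ T y → |Real.log ‖e y‖| < η

theorem NormalizedDiscFlow.exists_sectioned {X : Type*} [MetricSpace X] [CompactSpace X]
    {φ : ℝ → X → X} {e : X → ℂ} {p : X} {τ c r : ℝ} (h : NormalizedDiscFlow φ e p τ c r) :
    ∃ T η, SectionedDiscFlow φ e p τ c r T η := by
  obtain ⟨η₀, hη₀, hexp⟩ := Metric.continuousAt_iff.1 (Complex.continuous_exp.continuousAt (x := 0))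
    r h.r_pos
  obtain ⟨η, hη, hη'⟩ : ∃ η > 0, η < min 1 (η₀ / 2) := exists_between (by positivity)
  rw [lt_min_iff] at hη'
  have hη1 : 0 < 1 - Real.exp (-η) := by
    rw [sub_pos, Real.exp_lt_one_iff]
    linarith
  obtain ⟨T, h1, h2, h3, h4, h5⟩ := h.exists_time_function (lt_min h.r_pos hη1)
  refine ⟨T, η, h, hη, hη'.1, fun w hw n hn => ?_, h1, h2, h3, h4, fun y hy hyp hT => ?_,
    fun y hy hyp hT => ?_⟩
  · have e1 : Complex.exp w = Complex.exp (w - n * (2 * Real.pi * Complex.I)) := by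
      rw [Complex.exp_sub, Complex.exp_int_mul_two_pi_mul_I, div_one]
    have e2 := Complex.norm_le_abs_re_add_abs_im (w - n * (2 * Real.pi * Complex.I))
    have e3 := hexp (x := w - n * (2 * Real.pi * Complex.I)) (by
      rw [dist_zero_right]
      refine e2.trans_lt ?_
      have e4 : (w - n * (2 * Real.pi * Complex.I)).re = w.re := by simp
      have e5 : (w - n * (2 * Real.pi * Complex.I)).im = w.im - 2 * Real.pi * n := by
        simp; ring
      rw [e4, e5]
      linarith)
    rwa [Complex.exp_zero, dist_eq_norm, ← e1] at e3
  · have := h5 y hy hyp hT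
    linarith [min_le_left r (1 - Real.exp (-η))]
  · have h6 := h5 y hy hyp hT
    have h7 : Real.exp (-η) < ‖e y‖ := by linarith [min_le_right r (1 - Real.exp (-η))]
    have h8 := (Real.lt_log_iff_exp_lt ((Real.exp_pos _).trans h7)).2 h7
    have h9 := Real.log_nonpos (norm_nonneg _) hy.le
    rw [abs_of_nonpos h9]
    linarith

/-- A continuous choice of logarithms of `e` along the orbits of the points of `Q`. -/
structure IsLogLift {X : Type*} [MetricSpace X] (φ : ℝ → X → X) (e : X → ℂ) (Q : Set X)
    (V : ℝ × Q → ℂ) : Prop where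
  cont : Continuous V
  exp_eq : ∀ t ≥ -1, ∀ q : Q, Complex.exp (V (t, q)) = e (φ t q)

namespace SectionedDiscFlow

variable {X : Type*} [MetricSpace X] [CompactSpace X] {φ : ℝ → X → X} {e : X → ℂ} {p : X}
  {τ c r : ℝ} {T : X → ℝ} {η : ℝ}

theorem isClosed_section (h : SectionedDiscFlow φ e p τ c r T η) :
    IsClosed {x | ‖e x‖ < 1 ∧ x ≠ p ∧ T x = 0} := by
  obtain ⟨δ₁, hδ₁, h1⟩ := h.le_time 1
  obtain ⟨δ₂, hδ₂, h2⟩ := h.time_le (-1)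
  have hK : IsClosed {x | ‖e x‖ ≤ 1 - δ₁ ∧ δ₂ ≤ dist x p} :=
    (isClosed_le h.cont.norm continuous_const).inter
      (isClosed_le continuous_const (continuous_id.dist continuous_const))
  have hsub : {x | ‖e x‖ ≤ 1 - δ₁ ∧ δ₂ ≤ dist x p} ⊆ {x | ‖e x‖ < 1 ∧ x ≠ p} := by
    rintro x ⟨hx1, hx2⟩
    refine ⟨by linarith, ?_⟩
    rintro rfl
    rw [dist_self] at hx2
    linarith
  convert (h.contOn.mono hsub).preimage_isClosed_of_isClosed hK
    (isClosed_singleton (x := 0)) using 1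
  ext x
  constructor
  · rintro ⟨hx, hxp, hT⟩
    refine ⟨⟨?_, ?_⟩, hT⟩
    · by_contra! hcon
      linarith [h1 x hx hxp hcon]
    · by_contra! hcon
      linarith [h2 x hx hxp hcon]
  · rintro ⟨hx, hT⟩
    exact ⟨(hsub hx).1, (hsub hx).2, hT⟩

theorem exists_isLogLift (h : SectionedDiscFlow φ e p τ c r T η) {Q : Set X}
    (hQ : Q ⊆ {x | ‖e x‖ < 1 ∧ x ≠ p ∧ T x = 0}) {v : Q → ℂ} (hv : Continuous v)
    (hexp : ∀ q, Complex.exp (v q) = e q) :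
    ∃ V, IsLogLift φ e Q V ∧ ∀ q, V (0, q) = v q := by
  obtain ⟨V, hV, hVe, hV0⟩ := exists_log_lift (fun q : ℝ × Q => e (φ (max q.1 (-1)) q.2))
    (h.cont.comp (h.flow.continuous₂ (by fun_prop) (by fun_prop))) (fun q h0 => by
      obtain ⟨h1, h2, h3⟩ := hQ q.2.2
      have := h.lt_norm (φ (max q.1 (-1)) q.2) (h.norm_flow_lt_one h1 _) (h.flow_ne h2 _) (by
        rw [h.time_flow _ h1 h2, h3, zero_add]; exact le_max_right _ _)
      rw [h0, norm_zero] at this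
      linarith [h.r_lt]) v hv (fun q => by
      simp [hexp, h.flow.zero])
  exact ⟨V, ⟨hV, fun t ht q => by rw [hVe, max_eq_left ht]⟩, hV0⟩

variable {Q : Set X} {V : ℝ × Q → ℂ}

theorem lt_norm_lift (h : SectionedDiscFlow φ e p τ c r T η)
    (hQ : Q ⊆ {x | ‖e x‖ < 1 ∧ x ≠ p ∧ T x = 0}) (q : Q) {t : ℝ} (ht : -1 ≤ t) :
    1 - r < ‖e (φ t q)‖ := by
  obtain ⟨h1, h2, h3⟩ := hQ q.2
  exact h.lt_norm _ (h.norm_flow_lt_one h1 _) (h.flow_ne h2 _) (by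
    rw [h.time_flow _ h1 h2, h3, zero_add]; exact ht)

theorem norm_sub_one_lt (h : SectionedDiscFlow φ e p τ c r T η)
    (hQ : Q ⊆ {x | ‖e x‖ < 1 ∧ x ≠ p ∧ T x = 0}) (hV : IsLogLift φ e Q V) {q : Q} {t : ℝ}
    (ht : -1 ≤ t) {n : ℤ} (hn : |(V (t, q)).im - 2 * Real.pi * n| < η) :
    ‖e (φ t q) - 1‖ < r := by
  obtain ⟨h1, h2, h3⟩ := hQ q.2
  rw [← hV.exp_eq t ht]
  refine h.norm_exp_sub_one_lt _ ?_ n hn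
  rw [Complex.re_eq_log_norm_exp, hV.exp_eq t ht]
  exact h.abs_log_lt _ (h.norm_flow_lt_one h1 _) (h.flow_ne h2 _) (by
    rw [h.time_flow _ h1 h2, h3, zero_add]; exact ht)

theorem contOn_lift (hV : IsLogLift φ e Q V) (q : Q) (S : Set ℝ) :
    ContinuousOn (fun t => V (t, q)) S :=
  (hV.cont.comp (by fun_prop)).continuousOn

theorem exists_uniform_le_im (h : SectionedDiscFlow φ e p τ c r T η)
    (hQ : Q ⊆ {x | ‖e x‖ < 1 ∧ x ≠ p ∧ T x = 0}) (hQc : IsClosed Q) (hV : IsLogLift φ e Q V)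
    (K : ℝ) : ∃ S, ∀ t ≥ S, ∀ q, K < (V (t, q)).im := by
  have : CompactSpace Q := isCompact_iff_compactSpace.1 hQc.isCompact
  obtain ⟨n, hn⟩ : ∃ n : ℤ, K + 1 ≤ 2 * Real.pi * n := by
    obtain ⟨n, hn⟩ := exists_int_gt ((K + 1) / (2 * Real.pi))
    rw [div_lt_iff₀ (by positivity)] at hn
    exact ⟨n, by linarith⟩
  have key : ∃ S, ∀ t ≥ S, ∀ q ∈ (univ : Set Q), K < (V (t, q)).im := by
    refine isCompact_univ.induction_on (p := fun s => ∃ S, ∀ t ≥ S, ∀ q ∈ s, K < (V (t, q)).im)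
      ⟨0, by simp⟩ ?_ ?_ ?_
    · rintro s s' hss ⟨S, hS⟩
      exact ⟨S, fun t ht q hq => hS t ht q (hss hq)⟩
    · rintro s s' ⟨S, hS⟩ ⟨S', hS'⟩
      refine ⟨max S S', fun t ht q hq => ?_⟩
      rcases hq with hq | hq
      · exact hS t ((le_max_left _ _).trans ht) q hq
      · exact hS' t ((le_max_right _ _).trans ht) q hq
    · intro q _
      obtain ⟨h1, h2, h3⟩ := hQ q.2
      obtain ⟨S, hS, hSK⟩ := h.exists_le_im_lift h1 h2 (contOn_lift hV q (Ici (-1)))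
        (fun t ht => hV.exp_eq t ht q) (fun t ht => h.lt_norm_lift hQ q ht)
        (2 * Real.pi * n + 1)
      have hev : ∀ᶠ q' in 𝓝 q, 2 * Real.pi * n < (V (S, q')).im :=
        (Complex.continuous_im.comp (hV.cont.comp (by fun_prop :
          Continuous fun q' : Q => (S, q')))).continuousAt.eventually_const_lt
          (by simpa using (lt_add_one _).trans_le (hSK S le_rfl))
      refine ⟨_, mem_nhdsWithin_of_mem_nhds hev, S, fun t ht q' hq' => ?_⟩
      have := h.lt_im_lift (S := Ici (-1)) ordConnected_Ici (contOn_lift hV q' _)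
        (fun t ht => hV.exp_eq t ht q') (fun t ht => h.lt_norm_lift hQ q' ht) hS
        (hS.trans ht) ht (le_of_lt hq')
      linarith [h.c_lt]
  obtain ⟨S, hS⟩ := key
  exact ⟨S, fun t ht q => hS t ht q trivial⟩

theorem _root_.IsLogLift.exists_uniform_im_le (hV : IsLogLift φ e Q V) (hQc : IsClosed Q) (b : ℝ) :
    ∃ K, ∀ t ∈ Icc 0 b, ∀ q, (V (t, q)).im ≤ K := by
  have : CompactSpace Q := isCompact_iff_compactSpace.1 hQc.isCompact
  obtain ⟨K, hK⟩ := (isCompact_Icc.prod isCompact_univ).bddAbove_image (K := Icc 0 b ×ˢ univ)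
    (f := fun q => (V q).im) (Complex.continuous_im.comp hV.cont).continuousOn
  exact ⟨K, fun t ht q => hK ⟨(t, q), ⟨ht, trivial⟩, rfl⟩⟩

theorem im_eq_arg_of_near (h : SectionedDiscFlow φ e p τ c r T η)
    (hQ : Q ⊆ {x | ‖e x‖ < 1 ∧ x ≠ p ∧ T x = 0}) (hV : IsLogLift φ e Q V) {q : Q} {t : ℝ}
    (ht : -1 ≤ t) {n : ℤ} (hn : |(V (t, q)).im - 2 * Real.pi * n| < η) :
    (V (t, q)).im = 2 * Real.pi * n + (e (φ t q)).arg := by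
  obtain ⟨m, hm⟩ := Complex.exists_im_eq_arg_exp (V (t, q))
  rw [hV.exp_eq t ht] at hm
  have h0 := h.norm_sub_one_lt hQ hV ht hn
  have h1 := Complex.abs_arg_lt_pi_div_two_iff.2 (Or.inl (by
    simpa [h.flow.zero] using h.re_pos _ h0 0 (by simpa using h.τ_pos.le)))
  have hmn : m = n := by
    have hpi := Real.pi_gt_three
    have hη := h.η_lt
    rw [abs_lt] at h1 hn
    have h2 : 2 * Real.pi * ((m : ℝ) - n) < 2 * Real.pi * 1 := by linarith [h1.1, hn.2]
    have h3 : 2 * Real.pi * ((n : ℝ) - m) < 2 * Real.pi * 1 := by linarith [h1.2, hn.1]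
    have h4 := lt_of_mul_lt_mul_left h2 (by positivity)
    have h5 := lt_of_mul_lt_mul_left h3 (by positivity)
    have h6 : m - n < 1 := by exact_mod_cast h4
    have h7 : n - m < 1 := by exact_mod_cast h5
    omega
  rw [hm, hmn]

theorem sub_lt_of_near (h : SectionedDiscFlow φ e p τ c r T η)
    (hQ : Q ⊆ {x | ‖e x‖ < 1 ∧ x ≠ p ∧ T x = 0}) (hV : IsLogLift φ e Q V) {q : Q} {a b : ℝ}
    (ha : -1 ≤ a) (hb : -1 ≤ b) {n : ℤ} (hna : |(V (a, q)).im - 2 * Real.pi * n| < η)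
    (hnb : |(V (b, q)).im - 2 * Real.pi * n| < η) : b - a < 2 * τ := by
  by_contra! hcon
  have hτ := h.τ_pos
  have h1 := h.norm_sub_one_lt hQ hV ha hna
  have h2 := h.norm_sub_one_lt hQ hV hb hnb
  have h3 := h.im_lift_eq (S := Ici (-1)) ordConnected_Ici (contOn_lift hV q _)
    (fun t ht => hV.exp_eq t ht q) ha h1 (h.im_eq_arg_of_near hQ hV ha hna) (t := τ + a)
    (show -1 ≤ τ + a by linarith) (by simp [abs_of_pos hτ])
  have h4 := h.im_lift_eq (S := Ici (-1)) ordConnected_Ici (contOn_lift hV q _)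
    (fun t ht => hV.exp_eq t ht q) hb h2 (h.im_eq_arg_of_near hQ hV hb hnb) (t := -τ + b)
    (show -1 ≤ -τ + b by linarith) (by simp [abs_of_pos hτ])
  rw [← h.flow.add] at h3 h4
  have h5 := h.lt_arg_τ _ h1
  have h6 := h.arg_neg_lt _ h2
  have h7 := h.lt_im_lift (S := Ici (-1)) ordConnected_Ici (contOn_lift hV q _)
    (fun t ht => hV.exp_eq t ht q) (fun t ht => h.lt_norm_lift hQ q ht) (n := n)
    (t₁ := τ + a) (t₂ := -τ + b) (show -1 ≤ τ + a by linarith) (show -1 ≤ -τ + b by linarith)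
    (by linarith) (by linarith [h.c_pos])
  linarith

theorem exists_windows (h : SectionedDiscFlow φ e p τ c r T η) {Q : Bool → Set X}
    (hQ : ∀ l, Q l ⊆ {x | ‖e x‖ < 1 ∧ x ≠ p ∧ T x = 0}) (hQc : ∀ l, IsClosed (Q l))
    {V : ∀ l, ℝ × Q l → ℂ} (hV : ∀ l, IsLogLift φ e (Q l) (V l)) (ℓ : ℕ → ℝ) :
    ∃ (s : ℕ → ℝ) (n : ℕ → ℤ), s 0 = 1 ∧ ∀ k, s k + ℓ k ≤ s (k + 1) ∧
      (∀ l, ∀ t ∈ Icc 0 (s k + ℓ k), ∀ q, (V l (t, q)).im < 2 * Real.pi * n k - 1) ∧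
      ∀ l, ∀ t ≥ s (k + 1), ∀ q, 2 * Real.pi * n k + 1 < (V l (t, q)).im := by
  have hstep : ∀ (k : ℕ) (S : ℝ), ∃ (S' : ℝ) (n : ℤ), S + ℓ k ≤ S' ∧
      (∀ l, ∀ t ∈ Icc 0 (S + ℓ k), ∀ q, (V l (t, q)).im < 2 * Real.pi * n - 1) ∧
      ∀ l, ∀ t ≥ S', ∀ q, 2 * Real.pi * n + 1 < (V l (t, q)).im := by
    intro k S
    choose K hK using fun l => (hV l).exists_uniform_im_le (hQc l) (S + ℓ k)
    obtain ⟨n, hn⟩ := exists_int_gt ((max (K true) (K false) + 1) / (2 * Real.pi))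
    rw [div_lt_iff₀ (by positivity)] at hn
    choose S' hS' using fun l =>
      h.exists_uniform_le_im (hQ l) (hQc l) (hV l) (2 * Real.pi * n + 1)
    refine ⟨max (S + ℓ k) (max (S' true) (S' false)), n, le_max_left _ _, fun l t ht q => ?_,
      fun l t ht q => ?_⟩
    · have h1 : K l ≤ max (K true) (K false) := by cases l <;> simp
      linarith [hK l t ht q]
    · have h1 : S' l ≤ max (S' true) (S' false) := by cases l <;> simp
      exact hS' l t (h1.trans ((le_max_right _ _).trans ht)) q
  choose S' n hle h1 h2 using hstep
  let s : ℕ → ℝ := fun k => Nat.rec 1 (fun k S => S' k S) k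
  exact ⟨s, fun k => n k (s k), rfl, fun k => ⟨hle k (s k), h1 k (s k), h2 k (s k)⟩⟩

end SectionedDiscFlow

theorem exists_bump (s : ℝ) {ℓ : ℝ} (hℓ : 0 < ℓ) : ∃ b : ℝ → ℝ, Continuous b ∧ (∀ t, 0 ≤ b t) ∧
    (∀ t, b t ≤ 2 / ℓ) ∧ (∀ t ≤ s, b t = 0) ∧ (∀ t ≥ s + ℓ, b t = 0) ∧
    ∀ a ≤ s, ∀ t ≥ s + ℓ, ∫ x in a..t, b x = 1 := by
  obtain ⟨b, hb⟩ : ∃ b : ℝ → ℝ, ∀ t, b t = 6 / ℓ * max 0 ((t - s) / ℓ * (1 - (t - s) / ℓ)) :=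
    ⟨_, fun _ => rfl⟩
  have hbc : Continuous b := by
    rw [show b = _ from funext hb]
    fun_prop
  have hlow : ∀ t ≤ s, b t = 0 := fun t ht => by
    have h1 : (t - s) / ℓ ≤ 0 := div_nonpos_of_nonpos_of_nonneg (by linarith) hℓ.le
    rw [hb, max_eq_left (by nlinarith), mul_zero]
  have hhigh : ∀ t ≥ s + ℓ, b t = 0 := fun t ht => by
    have h1 : 1 ≤ (t - s) / ℓ := by rw [le_div_iff₀ hℓ]; linarith
    rw [hb, max_eq_left (by nlinarith), mul_zero]
  refine ⟨b, hbc, fun t => by rw [hb]; positivity, fun t => ?_, hlow, hhigh, fun a ha t ht => ?_⟩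
  · have h1 : max 0 ((t - s) / ℓ * (1 - (t - s) / ℓ)) ≤ 1 / 4 :=
      max_le (by norm_num) (by nlinarith [sq_nonneg ((t - s) / ℓ - 1 / 2)])
    rw [hb, show 2 / ℓ = 6 / ℓ * (1 / 3) by ring]
    gcongr
    linarith
  · have hi : ∀ u v, IntervalIntegrable b MeasureTheory.volume u v :=
      fun u v => hbc.intervalIntegrable u v
    rw [← intervalIntegral.integral_add_adjacent_intervals (hi a s) (hi s t),
      ← intervalIntegral.integral_add_adjacent_intervals (hi s (s + ℓ)) (hi (s + ℓ) t)]
    have e1 : ∫ x in a..s, b x = 0 := by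
      rw [intervalIntegral.integral_congr (g := fun _ => (0 : ℝ)), intervalIntegral.integral_zero]
      intro x hx
      rw [uIcc_of_le ha] at hx
      exact hlow x hx.2
    have e2 : ∫ x in (s + ℓ)..t, b x = 0 := by
      rw [intervalIntegral.integral_congr (g := fun _ => (0 : ℝ)), intervalIntegral.integral_zero]
      intro x hx
      rw [uIcc_of_le ht] at hx
      exact hhigh x hx.1
    have e3 : ∫ x in s..(s + ℓ), b x = 1 := by
      rw [intervalIntegral.integral_eq_sub_of_hasDerivAt
        (f := fun x => 3 * ((x - s) / ℓ) ^ 2 - 2 * ((x - s) / ℓ) ^ 3) ?_ (hi _ _)]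
      · simp only [add_sub_cancel_left, sub_self, div_self hℓ.ne']
        norm_num
      · intro x hx
        rw [uIcc_of_le (by linarith)] at hx
        have h1 : 0 ≤ (x - s) / ℓ := div_nonneg (by linarith [hx.1]) hℓ.le
        have h2 : (x - s) / ℓ ≤ 1 := by rw [div_le_one hℓ]; linarith [hx.2]
        have hd : HasDerivAt (fun x => (x - s) / ℓ) (1 / ℓ) x :=
          ((hasDerivAt_id x).sub_const s).div_const ℓ
        convert ((hd.pow 2).const_mul 3).sub ((hd.pow 3).const_mul 2) using 1
        · rfl
        · rw [hb, max_eq_right (by nlinarith)]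
          norm_num
          ring
    rw [e1, e2, e3]
    norm_num

namespace SectionedDiscFlow

variable {X : Type*} [MetricSpace X] [CompactSpace X] {φ : ℝ → X → X} {e : X → ℂ} {p : X}
  {τ c r : ℝ} {T : X → ℝ} {η : ℝ}

open scoped Classical in
/-- The function on the disc which is `D x * b t` at the point with time `t` on the orbit of a
point `x` of the section. -/
noncomputable def orbitProduct (φ : ℝ → X → X) (e : X → ℂ) (p : X) (T : X → ℝ) (D : X → ℝ)
    (b : ℝ → ℝ) (x : X) : ℝ :=
  if ‖e x‖ < 1 ∧ x ≠ p then D (φ (-T x) x) * b (T x) else 0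

theorem continuous_orbitProduct (h : SectionedDiscFlow φ e p τ c r T η) {D : X → ℝ}
    (hD : Continuous D) {b : ℝ → ℝ} (hb : Continuous b) (hb0 : ∀ t ≤ 0, b t = 0) {M : ℝ}
    (hbM : ∀ t ≥ M, b t = 0) : Continuous (orbitProduct φ e p T D b) := by
  refine continuous_iff_continuousAt.2 fun x => ?_
  by_cases hx : ‖e x‖ < 1 ∧ x ≠ p
  · have hWo : IsOpen {x | ‖e x‖ < 1 ∧ x ≠ p} :=
      (isOpen_lt h.cont.norm continuous_const).inter isOpen_ne
    have hT : ContinuousAt T x := h.contOn.continuousAt (hWo.mem_nhds hx)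
    have h1 : ContinuousAt (fun y => φ (-T y) y) x :=
      ContinuousAt.comp (g := fun q : ℝ × X => φ q.1 q.2) (f := fun y => (-T y, y))
        h.flow.1.continuousAt (hT.neg.prodMk continuousAt_id)
    have h2 : ContinuousAt (fun y => D (φ (-T y) y) * b (T y)) x :=
      (hD.continuousAt.comp (f := fun y => φ (-T y) y) h1).mul (hb.continuousAt.comp hT)
    refine h2.congr ?_
    filter_upwards [hWo.mem_nhds hx] with y hy
    exact (if_pos hy).symm
  · refine (continuousAt_const (y := (0 : ℝ))).congr ?_
    by_cases hxp : x = p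
    · obtain ⟨δ, hδ, hδ'⟩ := h.time_le 0
      filter_upwards [ball_mem_nhds x hδ] with y hy
      rw [orbitProduct]
      split_ifs with hyW
      · rw [hb0 _ (hδ' y hyW.1 hyW.2 (hxp ▸ hy)), mul_zero]
      · rfl
    · obtain ⟨δ, hδ, hδ'⟩ := h.le_time M
      have hx1 : 1 - δ < ‖e x‖ := by
        have : ¬ ‖e x‖ < 1 := fun h1 => hx ⟨h1, hxp⟩
        linarith
      filter_upwards [h.cont.norm.continuousAt.eventually_const_lt hx1] with y hy
      rw [orbitProduct]
      split_ifs with hyW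
      · rw [hbM _ (hδ' y hyW.1 hyW.2 hy), mul_zero]
      · rfl

theorem orbitProduct_flow (h : SectionedDiscFlow φ e p τ c r T η) (D : X → ℝ) (b : ℝ → ℝ) {x : X}
    (hx : ‖e x‖ < 1) (hxp : x ≠ p) (hT : T x = 0) (t : ℝ) :
    orbitProduct φ e p T D b (φ t x) = D x * b t := by
  rw [orbitProduct, if_pos ⟨h.norm_flow_lt_one hx t, h.flow_ne hxp t⟩, h.time_flow x hx hxp, hT,
    zero_add, h.flow.neg_apply]

theorem orbitProduct_of_not (D : X → ℝ) (b : ℝ → ℝ) {x : X} (hx : ¬ (‖e x‖ < 1 ∧ x ≠ p)) :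
    orbitProduct φ e p T D b x = 0 := if_neg hx

theorem abs_orbitProduct_le {D : X → ℝ} {b : ℝ → ℝ} {K L : ℝ} (hD : ∀ x, |D x| ≤ K)
    (hb0 : ∀ t, 0 ≤ b t) (hb : ∀ t, b t ≤ L) (x : X) : |orbitProduct φ e p T D b x| ≤ K * L := by
  have hK : 0 ≤ K := (abs_nonneg _).trans (hD x)
  have hL : 0 ≤ L := (hb0 0).trans (hb 0)
  rw [orbitProduct]
  split_ifs
  · rw [abs_mul, abs_of_nonneg (hb0 _)]
    exact mul_le_mul (hD _) (hb _) (hb0 _) hK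
  · rw [abs_zero]
    positivity

/-- Prescribed phases along orbits: a small continuous function whose integrals along the orbits
starting at the section take the values `A k` on the successive time windows. -/
theorem exists_prescribed_integrals (h : SectionedDiscFlow φ e p τ c r T η) {A : ℕ → X → ℝ}
    (hAc : ∀ k, Continuous (A k)) (hA : ∀ k x, |A k x| ≤ 3) {s : ℕ → ℝ} (hs0 : 0 ≤ s 0)
    (hs : ∀ k, s k + 48 * 2 ^ k ≤ s (k + 1)) :
    ∃ κ : X → ℝ, Continuous κ ∧ (∀ x, |κ x| ≤ 1 / 2) ∧ (∀ x, ¬ (‖e x‖ < 1 ∧ x ≠ p) → κ x = 0) ∧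
      ∀ x, ‖e x‖ < 1 → x ≠ p → T x = 0 → ∀ k, ∀ t ∈ Icc (s k + 48 * 2 ^ k) (s (k + 1)),
        ∫ u in (0 : ℝ)..t, κ (φ u x) = A k x := by
  have hℓ : ∀ k : ℕ, (0 : ℝ) < 48 * 2 ^ k := fun k => by positivity
  have hmono : Monotone s := monotone_nat_of_le_succ fun k => by linarith [hs k, hℓ k]
  have hsnn : ∀ k, 0 ≤ s k := fun k => hs0.trans (hmono k.zero_le)
  choose b hbc hb0 hble hblow hbhigh hbint using fun k => exists_bump (s k) (hℓ k)
  let D : ℕ → X → ℝ := fun k x => A k x - if k = 0 then 0 else A (k - 1) x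
  have hDc : ∀ k, Continuous (D k) := fun k => by
    by_cases hk : k = 0
    · simpa [D, hk] using hAc 0
    · simp only [D, hk, if_false]
      exact (hAc k).sub (hAc (k - 1))
  have hDb : ∀ k x, |D k x| ≤ 6 := fun k x => by
    have h1 := abs_le.1 (hA k x)
    have h2 := abs_le.1 (hA (k - 1) x)
    rw [abs_le]
    simp only [D]
    split_ifs <;> constructor <;> linarith [h1.1, h1.2, h2.1, h2.2]
  have hDsum : ∀ k x, ∑ j ∈ Finset.range (k + 1), D j x = A k x := by
    intro k x
    induction k with
    | zero => simp [D]
    | succ k ih => rw [Finset.sum_range_succ, ih]; simp [D]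
  let κ' : ℕ → X → ℝ := fun k => orbitProduct φ e p T (D k) (b k)
  have hκc : ∀ k, Continuous (κ' k) := fun k =>
    h.continuous_orbitProduct (hDc k) (hbc k) (fun t ht => hblow k t (ht.trans (hsnn k)))
      (hbhigh k)
  have hκb : ∀ k x, ‖κ' k x‖ ≤ 1 / 4 * (1 / 2) ^ k := fun k x => by
    refine (abs_orbitProduct_le (hDb k) (hb0 k) (hble k) x).trans (le_of_eq ?_)
    rw [one_div_pow]
    field_simp
    norm_num
  have hsum : HasSum (fun k : ℕ => (1 / 4 : ℝ) * (1 / 2) ^ k) (1 / 2) := by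
    have := hasSum_geometric_two.mul_left (1 / 4 : ℝ)
    rwa [show (1 / 4 : ℝ) * 2 = 1 / 2 by norm_num] at this
  refine ⟨fun x => ∑' k, κ' k x, continuous_tsum hκc hsum.summable hκb,
    fun x => tsum_of_norm_bounded hsum fun k => hκb k x, fun x hx => ?_,
    fun x hx hxp hT k t ht => ?_⟩
  · simp [κ', orbitProduct_of_not _ _ hx]
  · have h0t : 0 ≤ t := by linarith [hsnn k, hℓ k, ht.1]
    rw [intervalIntegral.integral_congr
      (g := fun u => ∑ j ∈ Finset.range (k + 1), D j x * b j u)]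
    · rw [intervalIntegral.integral_finsetSum fun j _ =>
        ((hbc j).intervalIntegrable _ _).const_mul _, ← hDsum k x]
      refine Finset.sum_congr rfl fun j hj => ?_
      rw [intervalIntegral.integral_const_mul, hbint j 0 (hsnn j) t, mul_one]
      have hjk : j ≤ k := Nat.lt_succ_iff.1 (Finset.mem_range.1 hj)
      rcases hjk.eq_or_lt with rfl | hlt
      · exact ht.1
      · linarith [hs j, hmono (show j + 1 ≤ k from hlt), hℓ k, ht.1]
    · intro u hu
      rw [uIcc_of_le h0t] at hu
      simp only [κ', h.orbitProduct_flow _ _ hx hxp hT]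
      refine tsum_eq_sum fun j hj => ?_
      rw [hblow j, mul_zero]
      have hjk : k + 1 ≤ j := by simpa using hj
      linarith [hmono hjk, hu.2, ht.2]

theorem exists_phase_density (h : SectionedDiscFlow φ e p τ c r T η) {Q : Bool → Set X}
    (hQ : ∀ l, Q l ⊆ {x | ‖e x‖ < 1 ∧ x ≠ p ∧ T x = 0}) (hQc : ∀ l, IsClosed (Q l))
    {V : ∀ l, ℝ × Q l → ℂ} (hV : ∀ l, IsLogLift φ e (Q l) (V l)) :
    ∃ κ : X → ℝ, Continuous κ ∧ (∀ x, |κ x| ≤ 1 / 2) ∧ (∀ x, ¬ (‖e x‖ < 1 ∧ x ≠ p) → κ x = 0) ∧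
      ∀ l, ∀ x y : Q l, x ≠ y → ∃ (N m m' : ℤ) (u v a b : ℝ), 0 ≤ a ∧ 0 ≤ b ∧ u ∈ Icc 0 1 ∧
        v ∈ Icc 0 1 ∧ 1 / 2 ≤ |u - v| ∧ |(V l (a, x)).im - 2 * Real.pi * N| < η / 2 ∧
        |(V l (b, y)).im - 2 * Real.pi * N| < η / 2 ∧
        a + ∫ t in (0 : ℝ)..a, κ (φ t x) = 3 * m + u ∧
        b + ∫ t in (0 : ℝ)..b, κ (φ t y) = 3 * m' + v := by
  have : Nonempty X := ⟨p⟩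
  have hη := h.η_pos
  have hη1 := h.η_lt
  obtain ⟨s, n, hs0, hsn⟩ := h.exists_windows hQ hQc hV (fun k => 48 * 2 ^ k)
  have hmono : Monotone s := monotone_nat_of_le_succ fun k => by
    have : (0 : ℝ) < 48 * 2 ^ k := by positivity
    linarith [(hsn k).1]
  obtain ⟨idx, hidx⟩ := exists_surjective_nat (ℕ × ℕ × Bool)
  let f : ℕ → X → ℝ := fun j x =>
    min 1 ((idx j).2.1 * dist x (TopologicalSpace.denseSeq X (idx j).1))
  let l : ℕ → Bool := fun j => (idx j).2.2
  have hsnn : ∀ k, 0 ≤ s k := fun k => by linarith [hmono k.zero_le]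
  have hnear : ∀ k l (q : Q l), ∃ a ≥ 0, |(V l (a, q)).im - 2 * Real.pi * n k| < η / 2 := by
    intro k l q
    have hℓ : (0 : ℝ) < 48 * 2 ^ k := by positivity
    have h1 := (hsn k).2.1 l (s k + 48 * 2 ^ k) ⟨by linarith [hsnn k], le_rfl⟩ q
    have h2 := (hsn k).2.2 l _ le_rfl q
    obtain ⟨a, ha, ha'⟩ := intermediate_value_Icc (hsn k).1
      (Complex.continuous_im.comp_continuousOn (contOn_lift (hV l) q _))
      (show 2 * Real.pi * n k ∈ Icc (V l (s k + 48 * 2 ^ k, q)).im (V l (s (k + 1), q)).im from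
        ⟨by linarith, by linarith⟩)
    exact ⟨a, by linarith [ha.1, hsnn k], by
      rw [show (V l (a, q)).im = _ from ha', sub_self, abs_zero]; linarith⟩
  have hwin : ∀ k l (q : Q l), ∀ a ≥ 0, |(V l (a, q)).im - 2 * Real.pi * n k| < η / 2 →
      a ∈ Icc (s k + 48 * 2 ^ k) (s (k + 1)) := by
    intro k l q a ha hna
    rw [abs_lt] at hna
    constructor
    · by_contra! hcon
      linarith [(hsn k).2.1 l a ⟨ha, hcon.le⟩ q, hna.1]
    · by_contra! hcon
      linarith [(hsn k).2.2 l a hcon.le q, hna.2]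
  choose A hAc hAb hA using fun j => exists_phase_functions h.cont h.inj (hQc (l j))
    (fun i x a => ∃ hx : x ∈ Q (l j), 0 ≤ a ∧
      |(V (l j) (a, ⟨x, hx⟩)).im - 2 * Real.pi * n (5 * j + i)| < η / 2)
    (fun i y hy => by
      obtain ⟨a, ha, hna⟩ := hnear (5 * j + i) (l j) ⟨y, hy⟩
      have hc : Continuous fun q : Q (l j) =>
          |(V (l j) (a, q)).im - 2 * Real.pi * n (5 * j + i)| :=
        ((Complex.continuous_im.comp ((hV (l j)).cont.comp (by fun_prop))).sub
          continuous_const).abs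
      refine ⟨a, ?_⟩
      rw [nhdsWithin_eq_map_subtype_coe hy, eventually_map]
      filter_upwards [hc.continuousAt.eventually_lt_const hna] with q hq
      exact ⟨q.2, ha, hq⟩)
    (f := f j) (by fun_prop) (fun x => by positivity) (fun x => min_le_left _ _)
  obtain ⟨κ, hκc, hκb, hκ0, hκ⟩ := h.exists_prescribed_integrals
    (A := fun k => A (k / 5) ⟨k % 5, Nat.mod_lt _ (by norm_num)⟩) (fun k => hAc _ _)
    (fun k => hAb _ _) (hsnn 0) fun k => (hsn k).1
  refine ⟨κ, hκc, hκb, hκ0, fun l' x y hxy => ?_⟩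
  have hd : 0 < dist x.1 y.1 := dist_pos.2 fun h1 => hxy (Subtype.ext h1)
  obtain ⟨m, hm⟩ := exists_nat_gt (1 / dist x.1 y.1)
  have hm0 : (0 : ℝ) < m := lt_trans (by positivity) hm
  rw [div_lt_iff₀ hd] at hm
  obtain ⟨d, hd'⟩ := (TopologicalSpace.denseRange_denseSeq X).exists_dist_lt x.1
    (show 0 < 1 / (4 * (m : ℝ)) by positivity)
  rw [lt_div_iff₀ (by positivity)] at hd'
  obtain ⟨j, hj⟩ := hidx (d, m, l')
  have hl : l j = l' := by simp [l, hj]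
  have hfj : ∀ z, f j z = min 1 (m * dist z (TopologicalSpace.denseSeq X d)) := fun z => by
    simp [f, hj]
  have hfx : f j x ≤ 1 / 4 := by
    rw [hfj]
    exact (min_le_right _ _).trans (by linarith)
  have hfy : 3 / 4 ≤ f j y := by
    rw [hfj]
    refine le_min (by norm_num) ?_
    nlinarith [dist_triangle_right x.1 y.1 (TopologicalSpace.denseSeq X d)]
  have hf0 : ∀ z, f j z ∈ Icc 0 1 := fun z => ⟨by positivity, min_le_left _ _⟩
  subst hl
  obtain ⟨i, ⟨a, m₁, ⟨_, ha0, ha⟩, hax⟩, b, m₂, ⟨_, hb0, hb⟩, hby⟩ := hA j x x.2 y y.2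
  have hk : ∀ z : Q (l j), ∀ t ∈ Icc (s (5 * j + i) + 48 * 2 ^ (5 * j + (i : ℕ)))
      (s (5 * j + i + 1)), ∫ u in (0 : ℝ)..t, κ (φ u z) = A j i z := by
    intro z t ht
    obtain ⟨h1, h2, h3⟩ := hQ _ z.2
    rw [hκ z h1 h2 h3 _ t ht]
    have e1 : (5 * j + (i : ℕ)) / 5 = j := by have := i.2; omega
    have e2 : (⟨(5 * j + (i : ℕ)) % 5, Nat.mod_lt _ (by norm_num)⟩ : Fin 5) = i := by
      ext
      have := i.2
      simp only
      omega
    rw [e1, e2]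
  refine ⟨n (5 * j + i), m₁, m₂, f j x, f j y, a, b, ha0, hb0, hf0 _, hf0 _, ?_, ha, hb, ?_, ?_⟩
  · rw [le_abs]
    right
    linarith
  · rw [hk x a (hwin _ _ x a ha0 ha), hax]
  · rw [hk y b (hwin _ _ y b hb0 hb), hby]

end SectionedDiscFlow

theorem abs_intervalIntegral_le {f : ℝ → ℝ} {K : ℝ} (hf : ∀ t, |f t| ≤ K) (a b : ℝ) :
    |∫ t in a..b, f t| ≤ K * |b - a| :=
  intervalIntegral.norm_integral_le_of_norm_le_const (f := f) fun t _ => hf t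

theorem Complex.exists_abs_arg_lt {ε : ℝ} (hε : 0 < ε) :
    ∃ δ > 0, ∀ z : ℂ, ‖z - 1‖ < δ → 0 < z.re ∧ |z.arg| < ε := by
  obtain ⟨δ, hδ, hδ'⟩ := Metric.continuousAt_iff.1
    (Complex.continuousAt_arg (x := 1) Complex.one_mem_slitPlane) ε hε
  refine ⟨min δ 1, by positivity, fun z hz => ⟨?_, ?_⟩⟩
  · have h1 := (Complex.abs_re_le_norm (z - 1)).trans_lt (hz.trans_le (min_le_right _ _))
    rw [Complex.sub_re, Complex.one_re, abs_lt] at h1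
    linarith [h1.1]
  · have := hδ' (x := z) (by rw [dist_eq_norm]; exact hz.trans_le (min_le_left _ _))
    simpa using this

namespace SectionedDiscFlow

variable {X : Type*} [MetricSpace X] [CompactSpace X] {φ : ℝ → X → X} {e : X → ℂ} {p : X}
  {τ c r : ℝ} {T : X → ℝ} {η : ℝ}

/-- The section is covered by two closed sets on which `e` has a logarithm. -/
theorem exists_branches (h : SectionedDiscFlow φ e p τ c r T η) :
    ∃ (Q : Bool → Set X) (V : ∀ l, ℝ × Q l → ℂ),
      (∀ l, Q l ⊆ {x | ‖e x‖ < 1 ∧ x ≠ p ∧ T x = 0}) ∧ (∀ l, IsClosed (Q l)) ∧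
      (∀ l, IsLogLift φ e (Q l) (V l)) ∧ ∃ δ > 0, ∀ x y, (‖e x‖ < 1 ∧ x ≠ p ∧ T x = 0) →
        (‖e y‖ < 1 ∧ y ≠ p ∧ T y = 0) → dist x y < δ → ∃ (l : Bool) (hx : x ∈ Q l) (hy : y ∈ Q l),
          ∀ t, |t| < δ → |(V l (t, ⟨y, hy⟩)).im - (V l (0, ⟨x, hx⟩)).im| < 1 := by
  let sg : Bool → ℂ := fun l => if l then 1 else -1
  have hsg : ∀ l, sg l = 1 ∨ sg l = -1 := fun l => by cases l <;> simp [sg]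
  let Q : Bool → Set X := fun l =>
    {x | ‖e x‖ < 1 ∧ x ≠ p ∧ T x = 0} ∩ {x | -(1 / 8) ≤ (sg l * e x).re}
  have hQ : ∀ l, Q l ⊆ {x | ‖e x‖ < 1 ∧ x ≠ p ∧ T x = 0} := fun l => inter_subset_left
  have hQc : ∀ l, IsClosed (Q l) := fun l => h.isClosed_section.inter
    (isClosed_le continuous_const (Complex.continuous_re.comp (continuous_const.mul h.cont)))
  have hlift : ∀ l, ∃ V, IsLogLift φ e (Q l) V := by
    intro l
    have hslit : ∀ q : Q l, sg l * e q ∈ Complex.slitPlane := by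
      rintro ⟨q, ⟨h1, h2, h3⟩, h4⟩
      have h5 := h.lt_norm q h1 h2 (by linarith)
      have h6 : ‖sg l * e q‖ = ‖e q‖ := by rcases hsg l with h7 | h7 <;> simp [h7]
      rw [Complex.mem_slitPlane_iff]
      by_contra! hcon
      have h7 := Complex.abs_re_eq_norm.2 hcon.2
      rw [h6, abs_of_nonpos hcon.1] at h7
      have h8 : -(1 / 8) ≤ (sg l * e q).re := h4
      linarith [h.r_lt]
    obtain ⟨w, hw⟩ : ∃ w, Complex.exp w = sg l := by
      rcases hsg l with h7 | h7
      · exact ⟨0, by rw [h7, Complex.exp_zero]⟩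
      · exact ⟨Real.pi * Complex.I, by rw [h7, Complex.exp_pi_mul_I]⟩
    obtain ⟨V, hV, -⟩ := h.exists_isLogLift (hQ l) (v := fun q => Complex.log (sg l * e q) + w)
      (((continuous_const.mul (h.cont.comp continuous_subtype_val)).clog hslit).add
        continuous_const)
      (fun q => by
        rw [Complex.exp_add, Complex.exp_log (Complex.slitPlane_ne_zero (hslit q)), hw]
        rcases hsg l with h7 | h7 <;> simp [h7])
    exact ⟨V, hV⟩
  choose V hV using hlift
  have huc : ∀ l, ∃ δ > 0, δ ≤ 1 ∧ ∀ x y : Q l, dist x y < δ → ∀ t, |t| < δ →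
      |(V l (t, y)).im - (V l (0, x)).im| < 1 := by
    intro l
    have : CompactSpace (Q l) := isCompact_iff_compactSpace.1 (hQc l).isCompact
    have hu := (isCompact_Icc (a := (-1 : ℝ)) (b := 1)).prod (isCompact_univ (X := Q l))
      |>.uniformContinuousOn_of_continuous
        (Complex.continuous_im.comp (hV l).cont).continuousOn
    obtain ⟨δ, hδ, hδ'⟩ := Metric.uniformContinuousOn_iff.1 hu 1 one_pos
    refine ⟨min δ 1, by positivity, min_le_right _ _, fun x y hxy t ht => ?_⟩
    rw [lt_min_iff] at hxy ht
    have ht' := abs_lt.1 ht.2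
    exact hδ' (t, y) ⟨⟨ht'.1.le, ht'.2.le⟩, trivial⟩ (0, x) ⟨by norm_num, trivial⟩ (by
      rw [Prod.dist_eq, max_lt_iff, Real.dist_eq, sub_zero, dist_comm]
      exact ⟨ht.1, hxy.1⟩)
  choose δ hδ hδ1 hVδ using huc
  obtain ⟨δ', hδ', he⟩ := Metric.uniformContinuous_iff.1
    (CompactSpace.uniformContinuous_of_continuous h.cont) (1 / 8) (by norm_num)
  refine ⟨Q, V, hQ, hQc, hV, min δ' (min (δ true) (δ false)),
    lt_min hδ' (lt_min (hδ _) (hδ _)), fun x y hx hy hxy => ?_⟩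
  have hle : ∀ l, min δ' (min (δ true) (δ false)) ≤ δ l := fun l => by cases l <;> simp
  have hre : ∀ l, |(sg l * e y).re - (sg l * e x).re| < 1 / 8 := fun l => by
    rw [← Complex.sub_re, ← mul_sub]
    refine (Complex.abs_re_le_norm _).trans_lt ?_
    have h1 := he (hxy.trans_le (min_le_left _ _))
    rw [dist_comm, dist_eq_norm] at h1
    rcases hsg l with h7 | h7
    · rwa [h7, one_mul]
    · rwa [h7, neg_one_mul, norm_neg]
  obtain ⟨l, hl⟩ : ∃ l, 0 ≤ (sg l * e x).re := by
    rcases le_total 0 (e x).re with h1 | h1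
    · exact ⟨true, by simpa [sg] using h1⟩
    · exact ⟨false, by simpa [sg] using h1⟩
  have hx' : -(1 / 8) ≤ (sg l * e x).re := by linarith
  have hy' : -(1 / 8) ≤ (sg l * e y).re := by linarith [(abs_lt.1 (hre l)).1]
  exact ⟨l, ⟨hx, hx'⟩, ⟨hy, hy'⟩, fun t ht =>
    hVδ l _ _ (hxy.trans_le (hle l)) t (ht.trans_le (hle l))⟩

variable {Q : Set X} {V : ℝ × Q → ℂ}

/-- Orbits with separated phases do not shadow each other under the time change. -/
theorem not_forall_near (h : SectionedDiscFlow φ e p τ c r T η)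
    (hQ : Q ⊆ {x | ‖e x‖ < 1 ∧ x ≠ p ∧ T x = 0}) (hV : IsLogLift φ e Q V)
    {ρ : X → ℝ} (hρ : Continuous ρ) (hρ0 : ∀ x, 1 / 2 ≤ ρ x) (hρ1 : ∀ x, ρ x ≤ 3 / 2)
    {g : ℝ → X → ℝ} (hg : Continuous fun q : ℝ × X => g q.1 q.2)
    (hgi : ∀ t x, ∫ s in (0 : ℝ)..(g t x), ρ (φ s x) = t)
    (hig : ∀ t x, g (∫ s in (0 : ℝ)..t, ρ (φ s x)) x = t) (hgm : ∀ x, StrictMono fun t => g t x)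
    (hgl : ∀ s t x, |g s x - g t x| ≤ 2 * |s - t|) {x y : Q} {s : ℝ} (hs : |s| ≤ 1 / 10)
    (h0 : |(V (g s y, y)).im - (V (0, x)).im| < 1) {δ : ℝ}
    (hδ : ∀ z : ℂ, ‖z - 1‖ < 2 * δ → 0 < z.re ∧ |z.arg| < η / 2) {N m m' : ℤ} {u v a b : ℝ}
    (ha : 0 ≤ a) (hb : 0 ≤ b) (hu : u ∈ Icc 0 1) (hv : v ∈ Icc 0 1) (huv : 1 / 2 ≤ |u - v|)
    (hna : |(V (a, x)).im - 2 * Real.pi * N| < η / 2)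
    (hnb : |(V (b, y)).im - 2 * Real.pi * N| < η / 2)
    (hax : ∫ t in (0 : ℝ)..a, ρ (φ t x) = 3 * m + u)
    (hby : ∫ t in (0 : ℝ)..b, ρ (φ t y) = 3 * m' + v) :
    ¬ ∀ t ≥ 0, ‖e (φ (g (t + s) y) y) - e (φ (g t x) x)‖ < δ := by
  intro hclose
  have hη1 := h.η_lt
  have hη := h.η_pos
  have hpi := Real.pi_gt_three
  have hg0 : ∀ z, g 0 z = 0 := fun z => by simpa using hig 0 z
  have hgx : ∀ t ≥ 0, 0 ≤ g t x := fun t ht => by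
    simpa [hg0] using (hgm x).monotone ht
  have hgy : ∀ t ≥ 0, -1 ≤ g (t + s) y := fun t ht => by
    have h1 : 0 ≤ g t y := by simpa [hg0] using (hgm y).monotone ht
    have h2 := hgl (t + s) t y
    rw [add_sub_cancel_left] at h2
    linarith [(abs_le.1 h2).1]
  let ν : ℝ → ℂ := fun t => V (g (t + s) y, y) - V (g t x, x)
  have hνc : Continuous ν :=
    (hV.cont.comp ((hg.comp (f := fun t : ℝ => (t + s, (y : X))) (by fun_prop)).prodMk
      continuous_const)).sub
    (hV.cont.comp ((hg.comp (f := fun t : ℝ => (t, (x : X))) (by fun_prop)).prodMk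
      continuous_const))
  have hexp : ∀ t ≥ 0, 0 < (Complex.exp (ν t)).re ∧ |(Complex.exp (ν t)).arg| < η / 2 := by
    intro t ht
    refine hδ _ ?_
    have h1 := h.lt_norm_lift hQ x (show -1 ≤ g t x by linarith [hgx t ht])
    have h2 : 1 / 2 < ‖e (φ (g t x) x)‖ := by linarith [h.r_lt]
    have h3 : e (φ (g t x) x) ≠ 0 := norm_pos_iff.1 (by linarith)
    rw [Complex.exp_sub, hV.exp_eq _ (hgy t ht), hV.exp_eq _ (by linarith [hgx t ht]),
      div_sub_one h3, norm_div, div_lt_iff₀ (by linarith)]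
    have h4 := hclose t ht
    have h5 := (norm_nonneg _).trans_lt h4
    nlinarith
  obtain ⟨n, hn⟩ := Complex.exists_im_eq_arg_exp (ν 0)
  have hn0 : n = 0 := by
    have h1 : (ν 0).im = (V (g s y, y)).im - (V (0, x)).im := by simp [ν, hg0]
    have h2 := abs_lt.1 (hexp 0 le_rfl).2
    rw [← h1, abs_lt] at h0
    have h3 : (n : ℝ) < 1 := by
      by_contra! hc
      nlinarith
    have h4 : (-1 : ℝ) < n := by
      by_contra! hc
      nlinarith
    have h5 : n < 1 := by exact_mod_cast h3
    have h6 : -1 < n := by exact_mod_cast h4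
    omega
  subst hn0
  obtain ⟨P, hP⟩ : ∃ P, P = ∫ t in (0 : ℝ)..a, ρ (φ t x) := ⟨_, rfl⟩
  have hP0 : 0 ≤ P := by
    rw [hP]
    exact intervalIntegral.integral_nonneg ha fun t _ => by linarith [hρ0 (φ t x)]
  have hgP : g P x = a := by rw [hP, hig]
  have key := isPreconnected_Ici.im_eq_arg_exp hνc.continuousOn (fun t ht => (hexp t ht).1)
    (self_mem_Ici (a := (0 : ℝ))) hn (x := P) hP0
  have harg := abs_lt.1 (hexp P hP0).2
  simp only [ν, hgP, Complex.sub_im, Int.cast_zero, mul_zero, zero_add] at key harg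
  rw [abs_lt] at hna hnb
  have hnb' : |(V (g (P + s) y, y)).im - 2 * Real.pi * N| < η := by
    rw [abs_lt]
    constructor <;> linarith
  have hnb'' : |(V (b, y)).im - 2 * Real.pi * N| < η := by
    rw [abs_lt]
    constructor <;> linarith
  have hb1 : -1 ≤ b := by linarith
  have d1 := h.sub_lt_of_near hQ hV (hgy P hP0) hb1 hnb' hnb''
  have d2 := h.sub_lt_of_near hQ hV hb1 (hgy P hP0) hnb'' hnb'
  have hi : ∀ z : X, ∀ u v, IntervalIntegrable (fun t => ρ (φ t z)) MeasureTheory.volume u v :=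
    fun z u v =>
      (hρ.comp (h.flow.continuous₂ continuous_id continuous_const)).intervalIntegrable u v
  have hd := intervalIntegral.integral_interval_sub_left (hi y 0 (g (P + s) y)) (hi y 0 b)
  have hd' := abs_intervalIntegral_le (f := fun t => ρ (φ t y)) (K := 3 / 2)
    (fun t => abs_le.2 ⟨by linarith [hρ0 (φ t y)], hρ1 _⟩) b (g (P + s) y)
  rw [← hd, hgi, hby] at hd'
  rw [hax] at hP
  have hab : |g (P + s) y - b| ≤ 1 / 5 := by
    rw [abs_le]
    constructor <;> linarith [h.τ_le]
  have hfin : |3 * (m : ℝ) + u + s - (3 * m' + v)| ≤ 3 / 10 := by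
    rw [← hP]
    linarith
  rw [abs_le] at hfin hs
  have hm : m = m' := by
    have h3 : ((m - m' : ℤ) : ℝ) < 1 := by
      push_cast
      linarith [hfin.2, hu.1, hv.2, hs.1]
    have h4 : (-1 : ℝ) < ((m - m' : ℤ) : ℝ) := by
      push_cast
      linarith [hfin.1, hu.2, hv.1, hs.2]
    have h5 : m - m' < 1 := by exact_mod_cast h3
    have h6 : -1 < m - m' := by exact_mod_cast h4
    omega
  subst hm
  rcases le_abs.1 huv with h1 | h1 <;> linarith [hfin.1, hfin.2, hs.1, hs.2]

end SectionedDiscFlow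

namespace SectionedDiscFlow

variable {X : Type*} [MetricSpace X] [CompactSpace X] {φ : ℝ → X → X} {e : X → ℂ} {p : X}
  {τ c r : ℝ} {T : X → ℝ} {η : ℝ}

/-- A point close to the section lies on a short orbit arc through a nearby point of the section. -/
theorem exists_near_section (h : SectionedDiscFlow φ e p τ c r T η) {ε : ℝ} (hε : 0 < ε) :
    ∃ δ > 0, ∀ x y, (‖e x‖ < 1 ∧ x ≠ p ∧ T x = 0) → dist x y < δ →
      |T y| < ε ∧ dist x (φ (-T y) y) < ε := by
  have hWo : IsOpen {x | ‖e x‖ < 1 ∧ x ≠ p} :=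
    (isOpen_lt h.cont.norm continuous_const).inter isOpen_ne
  have hT : ∀ x, (‖e x‖ < 1 ∧ x ≠ p ∧ T x = 0) → ContinuousAt T x := fun x hx =>
    h.contOn.continuousAt (hWo.mem_nhds ⟨hx.1, hx.2.1⟩)
  have hf : ∀ x ∈ {x | ‖e x‖ < 1 ∧ x ≠ p ∧ T x = 0},
      ContinuousAt (fun y => (T y, φ (-T y) y)) x := fun x hx =>
    (hT x hx).prodMk (ContinuousAt.comp (g := fun q : ℝ × X => φ q.1 q.2)
      (f := fun y => (-T y, y)) h.flow.1.continuousAt ((hT x hx).neg.prodMk continuousAt_id))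
  have hu := h.isClosed_section.isCompact.uniformContinuousAt_of_continuousAt _ hf
    (Metric.dist_mem_uniformity hε)
  obtain ⟨δ, hδ, hδ'⟩ := Metric.mem_uniformity_dist.1 hu
  refine ⟨δ, hδ, fun x y hx hxy => ?_⟩
  have h1 := hδ' hxy hx
  simp only [mem_ofPred_eq, Prod.dist_eq, max_lt_iff, hx.2.2, neg_zero, h.flow.zero] at h1
  rwa [dist_comm, Real.dist_eq, sub_zero] at h1

theorem exists_kinematicExpansive (h : SectionedDiscFlow φ e p τ c r T η) :
    ∃ ψ, IsTimeChange φ ψ ∧ KinematicExpansive ψ := by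
  obtain ⟨Q, V, hQ, hQc, hV, δ₁, hδ₁, hcover⟩ := h.exists_branches
  obtain ⟨κ, hκc, hκb, hκ0, hκ⟩ := h.exists_phase_density hQ hQc hV
  have hκb' := fun x => abs_le.1 (hκb x)
  have hρ : Continuous fun x => 1 + κ x := continuous_const.add hκc
  obtain ⟨ψ, g, hψ, hψg, hgc, hgi, hig, hgm, hgl⟩ := h.flow.exists_timeChange hρ
    (fun x => by linarith [(hκb' x).1])
  refine ⟨ψ, hψ, fun ε hε => ?_⟩
  have hψf := hψ.1
  have hφψ : ∀ t x, ∃ s, φ t x = ψ s x := fun t x =>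
    ⟨∫ s in (0 : ℝ)..t, (1 + κ (φ s x)), by rw [hψg, hig]⟩
  obtain ⟨δ₂, hδ₂, hexp⟩ := Complex.exists_abs_arg_lt (half_pos h.η_pos)
  obtain ⟨d, hd0, hd⟩ : ∃ d > 0, ‖e p‖ + 2 * d = 1 :=
    ⟨(1 - ‖e p‖) / 2, by linarith [h.norm_p], by ring⟩
  have huc := Metric.uniformContinuous_iff.1 (CompactSpace.uniformContinuous_of_continuous h.cont)
  obtain ⟨δ₃, hδ₃, huc₃⟩ := huc (min d (δ₂ / 2)) (by positivity)
  obtain ⟨δ₄, hδ₄, hbd⟩ := h.expansive_boundary hε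
  obtain ⟨δ₅, hδ₅, hsec⟩ := h.exists_near_section (ε := min δ₁ (min (ε / 2) (1 / 20)))
    (by positivity)
  refine ⟨min δ₃ (min δ₄ δ₅), by positivity, fun x y hxy => ?_⟩
  have hxy' : ∀ t, dist (ψ t x) (ψ t y) < δ₃ ∧ dist (ψ t x) (ψ t y) < δ₄ ∧
      dist (ψ t x) (ψ t y) < δ₅ := fun t => by
    simpa only [lt_min_iff] using hxy t
  have hbdry : ∀ x y : X, (∀ t, dist (ψ t x) (ψ t y) < δ₃) → ‖e x‖ = 1 → ‖e y‖ = 1 := by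
    intro x y hxy hx
    by_contra hy
    obtain ⟨t, -, ht⟩ := h.exists_near_repeller ((h.norm_le y).lt_of_ne hy) hδ₃
    obtain ⟨s, hs⟩ := hφψ t y
    have h1 := huc₃ ht
    have h2 := huc₃ (hxy s)
    rw [← hs, hψg, dist_eq_norm] at h2
    rw [dist_eq_norm] at h1
    have h3 := h.norm_flow_eq_one hx (g s x)
    have h4 := norm_sub_norm_le (e (φ (g s x) x)) (e (φ t y))
    have h5 := norm_sub_norm_le (e (φ t y)) (e p)
    linarith [min_le_left d (δ₂ / 2)]
  have hsing : ∀ y : X, (∀ t, dist (ψ t p) (ψ t y) < δ₃) → y = p := by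
    intro y hxy
    by_contra hy
    have hy1 : ‖e y‖ < 1 := (h.norm_le y).lt_of_ne fun h1 =>
      h.norm_p.ne (hbdry y p (fun t => by rw [dist_comm]; exact hxy t) h1)
    obtain ⟨t, ht⟩ := h.tendsto_norm hy1 hy hd0
    obtain ⟨s, hs⟩ := hφψ t y
    have h2 := huc₃ (hxy s)
    rw [← hs, hψg, h.fix_p, dist_comm, dist_eq_norm] at h2
    have h4 := norm_sub_norm_le (e (φ t y)) (e p)
    linarith [min_le_left d (δ₂ / 2), ht t le_rfl]
  have hxy₃ : ∀ t, dist (ψ t x) (ψ t y) < δ₃ := fun t => (hxy' t).1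
  have hyx₃ : ∀ t, dist (ψ t y) (ψ t x) < δ₃ := fun t => by rw [dist_comm]; exact hxy₃ t
  by_cases hx1 : ‖e x‖ = 1
  · have hψφ : ∀ z, ‖e z‖ = 1 → ∀ t, ψ t z = φ t z := fun z hz t => by
      have h1 : ∀ s, κ (φ s z) = 0 := fun s =>
        hκ0 _ fun h2 => h2.1.ne (h.norm_flow_eq_one hz s)
      have h2 := hig t z
      simp only [h1, add_zero, intervalIntegral.integral_const, sub_zero, smul_eq_mul,
        mul_one] at h2
      rw [hψg, h2]
    have hy1 := hbdry x y hxy₃ hx1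
    obtain ⟨s, hs, hys⟩ := hbd x y hx1 hy1 fun t => by
      rw [← hψφ x hx1, ← hψφ y hy1]
      exact (hxy' t).2.1
    exact ⟨s, hs, by rw [hψφ x hx1, hys]⟩
  by_cases hxp : x = p
  · subst hxp
    exact ⟨0, by simpa using hε, by rw [hψf.zero]; exact hsing y hxy₃⟩
  have hyp : y ≠ p := by
    rintro rfl
    exact hxp (hsing x hyx₃)
  have hx : ‖e x‖ < 1 := (h.norm_le x).lt_of_ne hx1
  have hy : ‖e y‖ < 1 := (h.norm_le y).lt_of_ne fun h1 => hx1 (hbdry y x hyx₃ h1)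
  obtain ⟨t₀, ht₀⟩ := hφψ (-T x) x
  have hC : ∀ z, ‖e z‖ < 1 → z ≠ p → ‖e (φ (-T z) z)‖ < 1 ∧ φ (-T z) z ≠ p ∧
      T (φ (-T z) z) = 0 := fun z hz hzp =>
    ⟨h.norm_flow_lt_one hz _, h.flow_ne hzp _, by rw [h.time_flow z hz hzp, add_neg_cancel]⟩
  obtain ⟨x', hx'⟩ : ∃ x', x' = ψ t₀ x := ⟨_, rfl⟩
  obtain ⟨y', hy'⟩ : ∃ y', y' = ψ t₀ y := ⟨_, rfl⟩
  have hx'C : ‖e x'‖ < 1 ∧ x' ≠ p ∧ T x' = 0 := by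
    rw [hx', ← ht₀]
    exact hC x hx hxp
  have hy'1 : ‖e y'‖ < 1 := by rw [hy', hψg]; exact h.norm_flow_lt_one hy _
  have hy'p : y' ≠ p := by rw [hy', hψg]; exact h.flow_ne hyp _
  have hcC := hC y' hy'1 hy'p
  obtain ⟨q, hq⟩ : ∃ q, q = φ (-T y') y' := ⟨_, rfl⟩
  rw [← hq] at hcC
  obtain ⟨hTy, hxq⟩ := hsec x' y' hx'C (by rw [hx', hy']; exact (hxy' t₀).2.2)
  rw [← hq, lt_min_iff] at hxq
  rw [lt_min_iff, lt_min_iff] at hTy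
  obtain ⟨s, hs⟩ : ∃ s, s = ∫ s in (0 : ℝ)..T y', (1 + κ (φ s q)) := ⟨_, rfl⟩
  have hgs : g s q = T y' := by rw [hs, hig]
  have hqy : ψ s q = y' := by rw [hψg, hgs, hq, h.flow.apply_neg]
  have hs1 : |s| ≤ 3 / 2 * |T y'| := by
    rw [hs]
    simpa using abs_intervalIntegral_le (f := fun s => 1 + κ (φ s q)) (K := 3 / 2)
      (fun t => abs_le.2 ⟨by linarith [(hκb' (φ t q)).1], by linarith [(hκb' (φ t q)).2]⟩) 0 (T y')
  by_cases hxq' : x' = q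
  · refine ⟨s, by linarith [hTy.2.1], hψf.injective t₀ ?_⟩
    rw [← hy', ← hqy, ← hxq', hx', hψf.add, hψf.add, add_comm]
  · exfalso
    obtain ⟨l, hxl, hql, hVl⟩ := hcover x' q hx'C hcC hxq.1
    obtain ⟨N, m, m', u, v, a, b, ha, hb, hu, hv, huv, hna, hnb, hax, hby⟩ :=
      hκ l ⟨x', hxl⟩ ⟨q, hql⟩ fun h1 => hxq' (congrArg Subtype.val h1)
    have h_int : ∀ z t, ∫ s in (0 : ℝ)..t, (1 + κ (φ s z)) = t + ∫ s in (0 : ℝ)..t, κ (φ s z) := by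
      intro z t
      have hi : Continuous fun s => κ (φ s z) :=
        hκc.comp (h.flow.continuous₂ continuous_id continuous_const)
      rw [intervalIntegral.integral_add intervalIntegrable_const (hi.intervalIntegrable _ _)]
      simp
    refine h.not_forall_near (hQ l) (hV l) hρ (fun x => by linarith [(hκb' x).1])
      (fun x => by linarith [(hκb' x).2]) hgc hgi hig hgm hgl (x := ⟨x', hxl⟩) (y := ⟨q, hql⟩)
      (s := s) (by linarith [hTy.2.2]) (hVl _ (by rw [hgs]; exact hTy.1)) (δ := δ₂ / 2)
      (fun z hz => hexp z (by linarith)) ha hb hu hv huv hna hnb ((h_int _ _).trans hax)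
      ((h_int _ _).trans hby) fun t _ => ?_
    have h1 := huc₃ (hyx₃ (t + t₀))
    rw [dist_eq_norm, ← hψf.add, ← hψf.add, ← hx', ← hy', ← hqy, hψf.add, hψg, hψg] at h1
    exact h1.trans_le (min_le_right _ _)

end SectionedDiscFlow

theorem DiscFlow.exists_kinematicExpansive {X : Type*} [MetricSpace X] [CompactSpace X]
    {φ : ℝ → X → X} {e : X → ℂ} {p : X} (h : DiscFlow φ e p) :
    ∃ ψ, IsTimeChange φ ψ ∧ KinematicExpansive ψ := by
  obtain ⟨e', τ, c, r, h'⟩ := h.exists_normalizedDiscFlow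
  obtain ⟨T, η, h''⟩ := h'.exists_sectioned
  exact h''.exists_kinematicExpansive

/-- A continuous flow on the closed unit disc with finitely many singularities,
whose interior singular point `p` is a repeller and such that every other
interior point has ω-limit set equal to the boundary circle, admits a
kinematic expansive time change. -/
theorem stmt13
    (φ : ℝ → (Metric.closedBall (0 : EuclideanSpace ℝ (Fin 2)) 1) →
      (Metric.closedBall (0 : EuclideanSpace ℝ (Fin 2)) 1))
    (hφ : IsFlow φ)
    (hfin : {q : Metric.closedBall (0 : EuclideanSpace ℝ (Fin 2)) 1 |
      ∀ t : ℝ, φ t q = q}.Finite)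
    (p : Metric.closedBall (0 : EuclideanSpace ℝ (Fin 2)) 1)
    (hpint : ‖(p : EuclideanSpace ℝ (Fin 2))‖ < 1)
    (hpfix : ∀ t : ℝ, φ t p = p)
    (hrep : AsympStable (fun t x => φ (-t) x) p)
    (homega : ∀ x : Metric.closedBall (0 : EuclideanSpace ℝ (Fin 2)) 1,
      ‖(x : EuclideanSpace ℝ (Fin 2))‖ < 1 → x ≠ p →
      OmegaLimit φ x = {z : Metric.closedBall (0 : EuclideanSpace ℝ (Fin 2)) 1 |
        ‖(z : EuclideanSpace ℝ (Fin 2))‖ = 1}) :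
    ∃ ψ, IsTimeChange φ ψ ∧ KinematicExpansive ψ := by
  have : CompactSpace (closedBall (0 : EuclideanSpace ℝ (Fin 2)) 1) :=
    isCompact_iff_compactSpace.1 (isCompact_closedBall _ _)
  let i : EuclideanSpace ℝ (Fin 2) ≃ₗᵢ[ℝ] ℂ := Complex.orthonormalBasisOneI.repr.symm
  have h : DiscFlow φ (fun x => i x) p :=
    { flow := hφ
      cont := i.continuous.comp continuous_subtype_val
      inj := i.injective.comp Subtype.val_injective
      range_eq := by
        rw [show (fun x : closedBall (0 : EuclideanSpace ℝ (Fin 2)) 1 => i x) = i ∘ Subtype.val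
          from rfl, range_comp, Subtype.range_coe, i.image_closedBall, map_zero]
      fin := hfin
      norm_p := by simpa using hpint
      fix_p := hpfix
      rep := hrep
      omega := by simpa using homega }
  exact h.exists_kinematicExpansive
end

section
/- Let φ be a positive kinematic expansive continuous flow on a compact metric space X and let γ be a periodic orbit of φ. Then there exists δ > 0 such that every x ∈ X with x ∉ γ and φ_t(x) ∈ B_δ(γ) for all t ≥ 0 is a periodic point. -/
open Metric Set Filter Topology

/-- Positive kinematic expansiveness. -/
def PosKinematicExpansive {X : Type*} [MetricSpace X] (φ : ℝ → X → X) : Prop :=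
  ∀ ε > (0 : ℝ), ∃ δ > (0 : ℝ), ∀ x y : X,
    (∀ t : ℝ, 0 ≤ t → dist (φ t x) (φ t y) < δ) → ∃ s : ℝ, |s| < ε ∧ y = φ s x

/-- For a positive kinematic expansive flow, near a periodic orbit `γ` every
point outside `γ` whose forward orbit stays `δ`-close to `γ` is periodic. -/
theorem stmt17 {X : Type*} [MetricSpace X] [CompactSpace X]
    (φ : ℝ → X → X) (hφ : IsFlow φ) (hpe : PosKinematicExpansive φ)
    (x₀ : X) (hx₀ : ¬ ∀ t : ℝ, φ t x₀ = x₀)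
    (T₀ : ℝ) (hT₀ : 0 < T₀) (hper : φ T₀ x₀ = x₀) :
    ∃ δ > (0 : ℝ), ∀ x : X,
      x ∉ Set.range (fun t => φ t x₀) →
      (∀ t : ℝ, 0 ≤ t →
        Metric.infDist (φ t x) (Set.range fun s => φ s x₀) < δ) →
      ((¬ ∀ t : ℝ, φ t x = x) ∧ ∃ T > (0 : ℝ), φ T x = x) := by
  obtain ⟨hc, h0, hadd⟩ := hφ
  have hcont (t : ℝ) : Continuous (φ t) := hc.comp (by fun_prop : Continuous fun x : X => (t, x))
  have horb (x : X) : Continuous fun t => φ t x :=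
    hc.comp (by fun_prop : Continuous fun t : ℝ => (t, x))
  have hfix (t : ℝ) : φ T₀ (φ t x₀) = φ t x₀ := by
    rw [hadd, add_comm, ← hadd, hper]
  set γ : Set X := Set.range fun s => φ s x₀
  have hγne : γ.Nonempty := Set.range_nonempty _
  have hγc : IsCompact γ := by
    refine Function.Periodic.compact_of_continuous (c := T₀) (fun t => ?_) hT₀.ne' (horb x₀)
    rw [← hadd, hper]
  have hsing : IsClosed {x : X | ∀ t, φ t x = x} := by
    rw [Set.ofPred_forall]
    exact isClosed_iInter fun t => isClosed_eq (hcont t) continuous_id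
  have hdisj : Disjoint γ {x : X | ∀ t, φ t x = x} := by
    rw [Set.disjoint_left]
    rintro _ ⟨s, rfl⟩ hs
    have hx : φ s x₀ = x₀ := by
      have h := hs (-s)
      simp only [hadd, neg_add_cancel, h0] at h
      exact h.symm
    simp only [hx] at hs
    exact hx₀ hs
  obtain ⟨δ₁, hδ₁, hthick⟩ := hdisj.exists_thickenings hγc hsing
  obtain ⟨η, hη, hexp⟩ := hpe T₀ hT₀
  obtain ⟨δ₂, hδ₂, huc⟩ := Metric.uniformContinuous_iff.1
    (CompactSpace.uniformContinuous_of_continuous (hcont T₀)) (η / 2) (half_pos hη)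
  refine ⟨min δ₁ (min δ₂ (η / 2)), by positivity, fun x _ hx => ⟨fun hs => ?_, ?_⟩⟩
  · have hxγ := hx 0 le_rfl
    rw [h0] at hxγ
    exact Set.disjoint_left.1 hthick
      ((Metric.mem_thickening_iff_infDist_lt hγne).2 (hxγ.trans_le (min_le_left _ _)))
      (Metric.self_subset_thickening hδ₁ _ hs)
  · obtain ⟨s, hs, hxs⟩ := hexp x (φ T₀ x) fun t ht => by
      obtain ⟨_, ⟨a, rfl⟩, ha⟩ := (Metric.infDist_lt_iff hγne).1 (hx t ht)
      simp only [lt_min_iff] at ha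
      have h := huc ha.2.1
      rw [hfix, dist_comm, hadd, add_comm, ← hadd] at h
      linarith [dist_triangle (φ t x) (φ a x₀) (φ t (φ T₀ x)), ha.2.2]
    refine ⟨T₀ - s, by linarith [(abs_lt.1 hs).2], ?_⟩
    rw [sub_eq_neg_add, ← hadd, hxs, hadd, neg_add_cancel, h0]
end

section
/- Let φ be a positive separating continuous flow on a compact metric space X and let p be a singular point of φ. If p belongs to the ω-limit set ω(x) of some x ∈ X, then x = p. In particular no singular point lies in the ω-limit set of a non-singular point. -/
open Metric Set Filter Topology

/-- A positive separating flow. -/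
def PosSeparating {X : Type*} [MetricSpace X] (φ : ℝ → X → X) : Prop :=
  ∃ δ > (0 : ℝ), ∀ x y : X,
    (∀ t : ℝ, 0 ≤ t → dist (φ t x) (φ t y) < δ) → ∃ s : ℝ, y = φ s x

/-- Near a singular point `p`, orbit segments of bounded length stay close to `p`. -/
theorem IsFlow.eventually_forall_dist_lt {X : Type*} [MetricSpace X] {φ : ℝ → X → X}
    (hφ : IsFlow φ) {p : X} (hp : ∀ t : ℝ, φ t p = p) {ε : ℝ} (hε : 0 < ε) (a b : ℝ) :
    ∀ᶠ z in 𝓝 p, ∀ t ∈ Icc a b, dist (φ t z) p < ε := by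
  refine isCompact_Icc.eventually_forall_of_forall_eventually fun t _ => ?_
  have hc : Continuous fun q : X × ℝ => dist (φ q.2 q.1) p :=
    (hφ.1.comp (continuous_snd.prodMk continuous_fst)).dist continuous_const
  refine hc.continuousAt.eventually_lt continuousAt_const ?_
  simpa [hp] using hε

/-- If the orbit of `x` leaves the `ε`-ball about a singular point `p ∈ ω(x)`, then some point of
that orbit outside the ball enters the ball and remains there for a time at least `n`. -/
theorem IsFlow.exists_long_stay {X : Type*} [MetricSpace X] {φ : ℝ → X → X}
    (hφ : IsFlow φ) {p x : X} (hp : ∀ t : ℝ, φ t p = p) (hpx : p ∈ OmegaLimit φ x)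
    {ε : ℝ} (hε : 0 < ε) {t₀ : ℝ} (ht₀ : ε ≤ dist (φ t₀ x) p) (n : ℝ) :
    ∃ z, ε ≤ dist z p ∧ ∀ t, 0 < t → t ≤ n → dist (φ t z) p ≤ ε := by
  obtain ⟨u, hu, hux⟩ := hpx
  obtain ⟨k, hk, hkt⟩ := ((hux.eventually (hφ.eventually_forall_dist_lt hp hε (-n) 0)).and
    (hu.eventually_ge_atTop t₀)).exists
  have hc : Continuous fun t => dist (φ t x) p :=
    (hφ.1.comp (continuous_id.prodMk continuous_const)).dist continuous_const
  have hK : IsCompact (Icc t₀ (u k) ∩ {t | ε ≤ dist (φ t x) p}) :=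
    isCompact_Icc.inter_right (isClosed_le continuous_const hc)
  obtain ⟨a, ⟨⟨ha₀, ha₁⟩, ha₂⟩, hmax⟩ := hK.exists_isGreatest ⟨t₀, ⟨le_rfl, hkt⟩, ht₀⟩
  refine ⟨φ a x, ha₂, fun t ht htn => ?_⟩
  rw [hφ.2.2]
  have hau : a < u k - n := by
    by_contra! h
    have hd := hk (a - u k) ⟨by linarith, by linarith⟩
    rw [hφ.2.2, sub_add_cancel] at hd
    exact absurd ha₂ (not_le.2 hd)
  by_contra! h
  have hle : t + a ≤ a := hmax ⟨⟨by linarith, by linarith⟩, h.le⟩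
  linarith

/-- For a positive separating flow, if a singular point `p` belongs to the
ω-limit set of `x`, then `x = p`. -/
theorem stmt18 {X : Type*} [MetricSpace X] [CompactSpace X]
    (φ : ℝ → X → X) (hφ : IsFlow φ) (hps : PosSeparating φ)
    (p x : X) (hp : ∀ t : ℝ, φ t p = p) (hpx : p ∈ OmegaLimit φ x) :
    x = p := by
  obtain ⟨δ, hδ, hsep⟩ := hps
  have eq_of_stays : ∀ y, (∀ t : ℝ, 0 ≤ t → dist (φ t y) p < δ) → y = p := fun y hy => by
    obtain ⟨s, hs⟩ := hsep p y fun t ht => by rw [hp, dist_comm]; exact hy t ht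
    rw [hs, hp]
  by_cases hx : ∀ t : ℝ, 0 ≤ t → dist (φ t x) p < δ / 2
  · exact eq_of_stays x fun t ht => (hx t ht).trans (half_lt_self hδ)
  push Not at hx
  obtain ⟨t₀, -, ht₀⟩ := hx
  let F : ℕ → Set X := fun n =>
    {z | δ / 2 ≤ dist z p ∧ ∀ t : ℝ, 0 < t → t ≤ n → dist (φ t z) p ≤ δ / 2}
  have hF : ∀ n, IsClosed (F n) := fun n => by
    simp only [F, ofPred_and, ofPred_forall]
    refine (isClosed_le continuous_const (continuous_id.dist continuous_const)).inter ?_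
    refine isClosed_iInter fun t => isClosed_iInter fun _ => isClosed_iInter fun _ => ?_
    exact isClosed_le ((hφ.1.comp (continuous_const.prodMk continuous_id)).dist continuous_const)
      continuous_const
  obtain ⟨y, hy⟩ := IsCompact.nonempty_iInter_of_sequence_nonempty_isCompact_isClosed F
    (fun n z hz => ⟨hz.1, fun t h0 hn => hz.2 t h0 (hn.trans (by simp))⟩)
    (fun n => hφ.exists_long_stay hp hpx (half_pos hδ) ht₀ n) (hF 0).isCompact hF
  rw [mem_iInter] at hy
  have hstay : φ 1 y = p := eq_of_stays _ fun t ht => by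
    obtain ⟨n, hn⟩ := exists_nat_ge (t + 1)
    rw [hφ.2.2]
    exact ((hy n).2 _ (by linarith) hn).trans_lt (half_lt_self hδ)
  have hyp : y = p := by
    rw [← hφ.2.1 y, ← neg_add_cancel (1 : ℝ), ← hφ.2.2, hstay, hp]
  have hdist := (hy 0).1
  rw [hyp, dist_self] at hdist
  linarith
end
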